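/- Fix an integer d ≥ 3 such that either (1) d is prime, or (2) there exists a prime q dividing d−1 with gcd(d−1, v_q(d−1)) = 1, where v_q denotes the q-adic valuation. Assume the Vojta-type hypothesis: there exist real constants C₁ = C₁(d) and C₂ = C₂(d) such that for every f ∈ ℤ[x] of degree d with nonzero discriminant and all integers x, y with y² = f(x), one has log max(1,|x|) ≤ C₁·h(f) + C₂, where h(f) denotes the maximum of log|a| over the nonzero coefficients a of f. For c a positive integer let φ_{(d,c)}(x) = x^d − cd·x^{d−1} + c(d−1) ∈ ℤ[x], and let B_d be the set of positive integers c such that φ_{(d,c)}^n(x) is irreducible over ℚ for all n ≥ 1 and gcd(c, d−1) = 1. Then for every c ∈ B_d there exists N such that for all n > N the extension K_n/K_{n−1} (for φ_{(d,c)}) is maximal, i.e. Gal(K_n/K_{n−1}) has order (d!)^{d^{n−1}}; consequently the arboreal image of φ_{(d,c)} has finite index in Aut(T_∞). -/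

import Mathlib

open Polynomial

noncomputable section

/-- The `n`-th iterate of a polynomial under composition: `polyIter φ 0 = X`,
`polyIter φ (n+1) = φ ∘ (polyIter φ n)`. -/
def polyIter {R : Type*} [CommRing R] (φ : Polynomial R) : ℕ → Polynomial R
  | 0 => X
  | n + 1 => φ.comp (polyIter φ n)

/-- The splitting field `K_n` of the `n`-th iterate of `φ ∈ ℤ[x]` over `ℚ`, inside a fixed
algebraic closure of `ℚ`. -/
def Kfield (φ : Polynomial ℤ) (n : ℕ) : IntermediateField ℚ (AlgebraicClosure ℚ) :=
  IntermediateField.adjoin ℚ ((polyIter φ n).rootSet (AlgebraicClosure ℚ))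

/-- The order of `Gal(K_n / K_{n-1})`: the number of automorphisms of `K_n` over `ℚ`
fixing every element of `K_{n-1}` pointwise. -/
def relGalCard (φ : Polynomial ℤ) (n : ℕ) : ℕ :=
  Nat.card {σ : Kfield φ n ≃ₐ[ℚ] Kfield φ n //
    ∀ (x : AlgebraicClosure ℚ) (_ : x ∈ Kfield φ (n - 1)) (hx' : x ∈ Kfield φ n),
      σ ⟨x, hx'⟩ = ⟨x, hx'⟩}

end

noncomputable section
/-- The (logarithmic) height of an integer polynomial: the maximum of `log |a|` over its
nonzero coefficients `a` (equivalently, `log` of the maximum of `|a|`). -/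
def intPolyHeight (f : Polynomial ℤ) : ℝ :=
  Real.log ((f.support.sup fun i => (f.coeff i).natAbs : ℕ) : ℝ)
end

theorem Nat.odd_factorization_of_dvd_squarefree {s b p : ℕ} (hs : Squarefree s) (hb : b ≠ 0)
    (hp : p.Prime) (hps : p ∣ s) : Odd ((b ^ 2 * s).factorization p) := by
  have h1 : s.factorization p = 1 := by
    have h2 := hs.natFactorization_le_one p
    have h3 := (hp.dvd_iff_one_le_factorization hs.ne_zero).1 hps
    omega
  rw [Nat.factorization_mul (pow_ne_zero 2 hb) hs.ne_zero, Nat.factorization_pow]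
  exact ⟨b.factorization p, by simp [h1]⟩

theorem Nat.dvd_of_squarefree_of_forall_prime {s m : ℕ} (hs : Squarefree s) (hm : m ≠ 0)
    (h : ∀ p : ℕ, p.Prime → p ∣ s → p ∣ m) : s ∣ m := by
  rw [← Nat.prod_primeFactors_of_squarefree hs]
  exact (Finset.prod_dvd_prod_of_subset _ _ _ fun p hp ↦ by
    simp only [Nat.mem_primeFactors] at hp ⊢
    exact ⟨hp.1, h p hp.1 hp.2.1, hm⟩).trans (Nat.prod_primeFactors_dvd m)

theorem intPolyHeight_C_mul_le {D : ℤ} (hD : D ≠ 0) {φ : ℤ[X]} (hφ : φ ≠ 0) :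
    intPolyHeight (C D * φ) ≤ Real.log D.natAbs + intPolyHeight φ := by
  unfold intPolyHeight
  have hM : ∀ f : ℤ[X], f ≠ 0 → 0 < f.support.sup fun i => (f.coeff i).natAbs := by
    intro f hf
    have := Finset.le_sup (f := fun i => (f.coeff i).natAbs) (natDegree_mem_support_of_nonzero hf)
    have h2 : f.coeff f.natDegree ≠ 0 := by simpa using hf
    omega
  have h0 := hM φ hφ
  rw [← Real.log_mul (by simpa using hD) (by exact_mod_cast h0.ne'), ← Nat.cast_mul]
  refine Real.log_le_log ?_ ?_
  · exact_mod_cast hM _ (mul_ne_zero (by simpa using hD) hφ)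
  · norm_cast
    refine Finset.sup_le fun i hi ↦ ?_
    rw [coeff_C_mul, Int.natAbs_mul]
    refine Nat.mul_le_mul_left _ (Finset.le_sup (f := fun i => (φ.coeff i).natAbs) ?_)
    simp only [mem_support_iff, coeff_C_mul] at hi ⊢
    exact right_ne_zero_of_mul hi

theorem intPolyHeight_nonneg (f : ℤ[X]) : 0 ≤ intPolyHeight f := Real.log_natCast_nonneg _

section Growth

variable {L : ℕ → ℝ}

theorem sum_le_two_mul_of_doubling (hL1 : 0 ≤ L 1) (hL : ∀ n, 1 ≤ n → 2 * L n ≤ L (n + 1)) (m : ℕ)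
    (hm : 1 ≤ m) : ∑ j ∈ Finset.Icc 1 m, L j ≤ 2 * L m := by
  induction m, hm using Nat.le_induction with
  | base => simp; linarith
  | succ m hm ih =>
    rw [Finset.sum_Icc_succ_top (by omega)]
    linarith [hL m hm]

theorem two_pow_mul_le_of_doubling (hL : ∀ n, 1 ≤ n → 2 * L n ≤ L (n + 1)) (m k : ℕ)
    (hm : 1 ≤ m) : 2 ^ k * L m ≤ L (m + k) := by
  induction k with
  | zero => simp
  | succ k ih =>
    have := hL (m + k) (by omega)
    rw [pow_succ, ← add_assoc]
    linarith

theorem one_le_of_doubling (hL1 : 1 ≤ L 1) (hL : ∀ n, 1 ≤ n → 2 * L n ≤ L (n + 1)) (m : ℕ)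
    (hm : 1 ≤ m) : 1 ≤ L m := by
  induction m, hm using Nat.le_induction with
  | base => exact hL1
  | succ m hm ih => linarith [hL m hm]

end Growth

section Orbit

variable {φ : ℤ[X]} {a : ℕ → ℤ}

theorem dvd_orbit_add_sub (hstep : ∀ n, a (n + 1) = φ.eval (a n)) (ha0 : a 0 = 0) {p : ℤ} (k j : ℕ)
    (hk : p ∣ a k) : p ∣ a (k + j) - a j := by
  induction j with
  | zero => simpa [ha0] using hk
  | succ j ih =>
    rw [← add_assoc, hstep, hstep]
    exact ih.trans (sub_dvd_eval_sub _ _ _)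

/-- Under a Vojta-type bound for `y² = f(x)`, a rapidly growing orbit has, from some point on,
terms with a primitive prime divisor of odd multiplicity avoiding any given finite set of primes. -/
theorem exists_primitive_prime_odd_factorization {d : ℕ}
    (hVojta : ∃ C₁ C₂ : ℝ, ∀ f : Polynomial ℤ, f.natDegree = d →
      Squarefree (f.map (algebraMap ℤ ℚ)) →
      ∀ x y : ℤ, y ^ 2 = f.eval x →
        Real.log (max 1 |(x : ℝ)|) ≤ C₁ * intPolyHeight f + C₂)
    (hdeg : φ.natDegree = d) (hsq : Squarefree (φ.map (algebraMap ℤ ℚ))) (ha0 : a 0 = 0)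
    (hstep : ∀ n, a (n + 1) = φ.eval (a n)) (h1 : 4 ≤ |a 1|)
    (hgrow : ∀ n, 1 ≤ n → (a n) ^ 2 ≤ |a (n + 1)|) {E : ℕ} (hE : E ≠ 0) :
    ∃ N : ℕ, ∀ n, N < n → ∃ p : ℕ, p.Prime ∧ ¬ p ∣ E ∧
      (∀ k, 1 ≤ k → k ≤ n → ¬ (p : ℤ) ∣ a k) ∧ Odd ((a (n + 1)).natAbs.factorization p) := by
  obtain ⟨C₁, C₂, hV⟩ := hVojta
  have hφ0 : φ ≠ 0 := by
    rintro rfl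
    simp at hsq
  have habs : ∀ n, 1 ≤ n → 4 ≤ |a n| := by
    intro n hn
    induction n, hn using Nat.le_induction with
    | base => exact h1
    | succ n hn ih =>
      have := hgrow n hn
      rw [← sq_abs] at this
      nlinarith
  have hne : ∀ n, 1 ≤ n → a n ≠ 0 := fun n hn h ↦ by simpa [h] using habs n hn
  set L : ℕ → ℝ := fun n ↦ Real.log |(a n : ℝ)| with hLdef
  have hL : ∀ n, 1 ≤ n → 2 * L n ≤ L (n + 1) := by
    intro n hn
    have h2 : ((a n : ℝ)) ^ 2 ≤ |(a (n + 1) : ℝ)| := by exact_mod_cast hgrow n hn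
    have h3 : (a n : ℝ) ≠ 0 := by exact_mod_cast hne n hn
    rw [← sq_abs] at h2
    calc 2 * L n = Real.log (|(a n : ℝ)| ^ 2) := by rw [Real.log_pow]; simp [hLdef]
      _ ≤ _ := Real.log_le_log (by positivity) h2
  have hL1 : 1 ≤ L 1 := by
    have h4 : (4 : ℝ) ≤ |(a 1 : ℝ)| := by exact_mod_cast h1
    rw [hLdef]
    simp only
    rw [Real.le_log_iff_exp_le (by linarith)]
    linarith [Real.exp_one_lt_d9]
  set B : ℝ := |C₁| * (Real.log E + intPolyHeight φ) + |C₂| with hB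
  have hB0 : 0 ≤ B := by
    have := intPolyHeight_nonneg φ
    have := Real.log_natCast_nonneg E
    positivity
  obtain ⟨T, hT⟩ := pow_unbounded_of_one_lt (2 * |C₁| + B) (one_lt_two (α := ℝ))
  refine ⟨2 * T + 1, fun n hn ↦ ?_⟩
  by_contra! hcon
  set m := (n + 1) / 2 with hm
  obtain ⟨s, b, hsb, hs⟩ := Nat.sq_mul_squarefree (a (n + 1)).natAbs
  have han : a (n + 1) ≠ 0 := hne _ (by omega)
  have hb : b ≠ 0 := by
    rintro rfl
    simp at hsb
    omega
  have hprod : ∏ j ∈ Finset.Icc 1 m, (a j).natAbs ≠ 0 :=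
    Finset.prod_ne_zero_iff.2 fun j hj ↦ by simpa using hne j (Finset.mem_Icc.1 hj).1
  have hdvd : s ∣ E * ∏ j ∈ Finset.Icc 1 m, (a j).natAbs := by
    refine Nat.dvd_of_squarefree_of_forall_prime hs (mul_ne_zero hE hprod) fun p hp hps ↦ ?_
    by_cases hpE : p ∣ E
    · exact hpE.mul_right _
    refine Dvd.dvd.mul_left ?_ _
    have hodd : Odd ((a (n + 1)).natAbs.factorization p) := by
      rw [← hsb]; exact Nat.odd_factorization_of_dvd_squarefree hs hb hp hps
    have hpa : (p : ℤ) ∣ a (n + 1) := by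
      rw [Int.natCast_dvd, ← hsb]; exact hps.mul_left _
    have : ∃ k, 1 ≤ k ∧ k ≤ n ∧ (p : ℤ) ∣ a k := by
      by_contra! h
      exact hcon p hp hpE h hodd
    obtain ⟨k, hk1, hkn, hpk⟩ := this
    have h2 : (p : ℤ) ∣ a (n + 1 - k) := by
      have := dvd_orbit_add_sub hstep ha0 k (n + 1 - k) hpk
      rw [show k + (n + 1 - k) = n + 1 by omega] at this
      simpa using dvd_sub hpa this
    have : ∃ j ∈ Finset.Icc 1 m, (p : ℤ) ∣ a j := by
      by_cases hkm : k ≤ m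
      · exact ⟨k, Finset.mem_Icc.2 ⟨hk1, hkm⟩, hpk⟩
      · exact ⟨n + 1 - k, Finset.mem_Icc.2 ⟨by omega, by omega⟩, h2⟩
    obtain ⟨j, hj, hpj⟩ := this
    exact (Int.natCast_dvd.1 hpj).trans (Finset.dvd_prod_of_mem (fun j ↦ (a j).natAbs) hj)
  have hs0 : s ≠ 0 := hs.ne_zero
  have hlogs : Real.log s ≤ Real.log E + ∑ j ∈ Finset.Icc 1 m, L j := by
    have h3 := Nat.le_of_dvd (Nat.pos_of_ne_zero (mul_ne_zero hE hprod)) hdvd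
    calc Real.log s ≤ Real.log ((E * ∏ j ∈ Finset.Icc 1 m, (a j).natAbs : ℕ) : ℝ) :=
          Real.log_le_log (by exact_mod_cast Nat.pos_of_ne_zero hs0) (by exact_mod_cast h3)
      _ = _ := by
        rw [Nat.cast_mul, Real.log_mul (by exact_mod_cast hE) (by exact_mod_cast hprod),
          Nat.cast_prod, Real.log_prod (fun j hj ↦ by
            simpa using hne j (Finset.mem_Icc.1 hj).1)]
        simp [hLdef, Nat.cast_natAbs]
  obtain ⟨D, hDs, hDa⟩ : ∃ D : ℤ, D.natAbs = s ∧ a (n + 1) = D * b ^ 2 := by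
    refine ⟨(a (n + 1)).sign * s, by simp [Int.natAbs_mul, Int.natAbs_sign_of_ne_zero han], ?_⟩
    conv_lhs => rw [← Int.sign_mul_natAbs (a (n + 1)), ← hsb]
    push_cast
    ring
  have hD0 : D ≠ 0 := by rintro rfl; simp at hDs; omega
  have hkey := hV (C D * φ) (by rw [natDegree_C_mul hD0, hdeg]) (by
    rw [Polynomial.map_mul, map_C]
    refine (Associated.squarefree_iff ?_).1 hsq
    exact associated_unit_mul_right _ _ (isUnit_C.2 (by simpa using hD0))) (a n) (D * b) (by
    rw [eval_mul, eval_C, ← hstep, hDa]; ring)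
  have hh := intPolyHeight_C_mul_le hD0 hφ0
  rw [hDs] at hh
  have hm1 : 1 ≤ m := by omega
  have hsum := sum_le_two_mul_of_doubling (by linarith) hL m hm1
  have hLm := one_le_of_doubling hL1 hL m hm1
  have hLn : L n ≤ Real.log (max 1 |(a n : ℝ)|) :=
    Real.log_le_log (by simpa using hne n (by omega)) (le_max_right _ _)
  have hpow := two_pow_mul_le_of_doubling hL m (n - m) hm1
  rw [show m + (n - m) = n by omega] at hpow
  have hpow2 : (2 : ℝ) ^ T ≤ 2 ^ (n - m) := pow_le_pow_right₀ one_le_two (by omega)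
  have hC : C₁ * intPolyHeight (C D * φ) ≤
      |C₁| * (Real.log E + 2 * L m + intPolyHeight φ) :=
    (mul_le_mul_of_nonneg_right (le_abs_self _) (intPolyHeight_nonneg _)).trans
      (mul_le_mul_of_nonneg_left (by linarith) (abs_nonneg _))
  have hC2 := le_abs_self C₂
  have h5 : 2 ^ (n - m) * L m ≤ 2 * |C₁| * L m + B := by
    rw [hB]; linarith
  nlinarith

end Orbit

section Iterates

variable {R : Type*} [CommRing R] (φ : R[X])

@[simp] theorem polyIter_zero : polyIter φ 0 = X := rfl

theorem polyIter_succ (n : ℕ) : polyIter φ (n + 1) = φ.comp (polyIter φ n) := rfl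

@[simp] theorem polyIter_one : polyIter φ 1 = φ := by simp [polyIter_succ]

theorem polyIter_add (m n : ℕ) : polyIter φ (m + n) = (polyIter φ m).comp (polyIter φ n) := by
  induction m with
  | zero => simp
  | succ m ih => rw [Nat.succ_add, polyIter_succ, polyIter_succ, ih, comp_assoc]

theorem polyIter_succ' (n : ℕ) : polyIter φ (n + 1) = (polyIter φ n).comp φ := by
  rw [polyIter_add, polyIter_one]

theorem polyIter_natDegree [IsDomain R] (n : ℕ) :
    (polyIter φ n).natDegree = φ.natDegree ^ n := by
  induction n with
  | zero => simp
  | succ n ih => rw [polyIter_succ, natDegree_comp, ih, pow_succ']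

variable {φ} in
theorem Polynomial.Monic.polyIter [IsDomain R] (hφ : φ.Monic) (hd : φ.natDegree ≠ 0) (n : ℕ) :
    (polyIter φ n).Monic := by
  induction n with
  | zero => exact monic_X
  | succ n ih =>
    refine hφ.comp ih ?_
    rw [polyIter_natDegree]
    exact pow_ne_zero _ hd

variable {A : Type*} [CommRing A] [Algebra R A]

theorem aeval_polyIter_succ' (n : ℕ) (x : A) :
    aeval x (polyIter φ (n + 1)) = aeval (aeval x φ) (polyIter φ n) := by
  rw [polyIter_succ', aeval_comp]

end Iterates

/-- The trinomial `x^d - c d x^(d-1) + c (d-1)`, whose critical points are `0` and its own value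
`c (d-1)` at `0`. -/
noncomputable def critTrinomial (c d : ℕ) : ℤ[X] :=
  X ^ d - C ((c : ℤ) * d) * X ^ (d - 1) + C ((c : ℤ) * ((d : ℤ) - 1))

section critTrinomial

variable {c d : ℕ}

theorem aeval_critTrinomial {A : Type*} [CommRing A] (hd : 1 ≤ d) (x : A) :
    aeval x (critTrinomial c d) = x ^ (d - 1) * (x - c * d) + c * ((d - 1 : ℕ) : A) := by
  obtain ⟨m, rfl⟩ := Nat.exists_eq_add_of_le' hd
  simp [critTrinomial, pow_succ]
  ring

theorem eval_critTrinomial (hd : 1 ≤ d) (x : ℤ) :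
    (critTrinomial c d).eval x = x ^ (d - 1) * (x - c * d) + c * ((d - 1 : ℕ) : ℤ) := by
  simpa using aeval_critTrinomial (c := c) hd x

theorem critTrinomial_eq : critTrinomial c d =
    X ^ d + (C ((c : ℤ) * ((d : ℤ) - 1)) - C ((c : ℤ) * d) * X ^ (d - 1)) := by
  rw [critTrinomial]; ring

theorem degree_critTrinomial_tail_lt (hd : 2 ≤ d) :
    (C ((c : ℤ) * ((d : ℤ) - 1)) - C ((c : ℤ) * d) * X ^ (d - 1) : ℤ[X]).degree < d := by
  refine (degree_sub_le _ _).trans_lt (max_lt ?_ ?_)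
  · exact degree_C_le.trans_lt (by exact_mod_cast (by omega : 0 < d))
  · exact (degree_C_mul_X_pow_le _ _).trans_lt (by exact_mod_cast (by omega : d - 1 < d))

theorem critTrinomial_monic (hd : 2 ≤ d) : (critTrinomial c d).Monic := by
  rw [critTrinomial_eq]
  exact monic_X_pow_add (degree_critTrinomial_tail_lt hd)

theorem critTrinomial_natDegree (hd : 2 ≤ d) : (critTrinomial c d).natDegree = d := by
  rw [critTrinomial_eq, natDegree_eq_of_degree_eq (degree_add_eq_left_of_degree_lt _)]
  · simp
  · simpa using degree_critTrinomial_tail_lt hd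

theorem derivative_critTrinomial (hd : 3 ≤ d) : derivative (critTrinomial c d) =
    C (d : ℤ) * X ^ (d - 2) * (X - C ((c : ℤ) * ((d - 1 : ℕ) : ℤ))) := by
  obtain ⟨m, rfl⟩ := Nat.exists_eq_add_of_le' hd
  simp [critTrinomial, show m + 3 - 1 = m + 2 from rfl,
    show m + 3 - 2 = m + 1 from rfl]
  ring

/-- The orbit of the critical point `0`. -/
noncomputable def critOrbit (c d n : ℕ) : ℤ := (polyIter (critTrinomial c d) n).eval 0

theorem critOrbit_zero : critOrbit c d 0 = 0 := by simp [critOrbit]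

theorem critOrbit_succ (n : ℕ) :
    critOrbit c d (n + 1) = (critTrinomial c d).eval (critOrbit c d n) := by
  rw [critOrbit, polyIter_succ, eval_comp, critOrbit]

theorem critOrbit_one (hd : 2 ≤ d) : critOrbit c d 1 = c * ((d - 1 : ℕ) : ℤ) := by
  rw [critOrbit_succ, critOrbit_zero, eval_critTrinomial (by omega)]
  simp [show d - 1 ≠ 0 by omega]

theorem eval_critOrbit (m n : ℕ) :
    (polyIter (critTrinomial c d) n).eval (critOrbit c d m) = critOrbit c d (n + m) := by
  rw [critOrbit, critOrbit, polyIter_add, eval_comp]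

theorem two_le_of_irreducible_critTrinomial (hd : 3 ≤ d) (hc : 0 < c)
    (hirr : Irreducible ((critTrinomial c d).map (algebraMap ℤ ℚ))) : 2 ≤ c := by
  by_contra! h
  obtain rfl : c = 1 := by omega
  have h1 : ((critTrinomial 1 d).map (algebraMap ℤ ℚ)).IsRoot 1 := by
    have := aeval_critTrinomial (c := 1) (by omega : 1 ≤ d) (1 : ℚ)
    rw [aeval_def, ← eval_map] at this
    rw [IsRoot, this]
    push_cast [show 1 ≤ d by omega]
    simp
  have h2 := degree_eq_one_of_irreducible_of_root hirr h1
  have h3 : _ = 1 := natDegree_eq_of_degree_eq_some h2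
  rw [natDegree_map_eq_of_injective (algebraMap ℤ ℚ).injective_int,
    critTrinomial_natDegree (by omega)] at h3
  omega

theorem le_abs_eval_critTrinomial (hd : 3 ≤ d) {x : ℤ} (hx : c * d + 2 ≤ |x|) :
    x ^ 2 ≤ |(critTrinomial c d).eval x| := by
  obtain ⟨m, rfl⟩ := Nat.exists_eq_add_of_le' (by omega : 1 ≤ d)
  rw [eval_critTrinomial (by omega)]
  simp only [add_tsub_cancel_right]
  push_cast at hx ⊢
  have h1 : 2 ≤ |x - c * (m + 1)| := by
    have := abs_sub_abs_le_abs_sub x (c * (m + 1) : ℤ)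
    rw [abs_of_nonneg (by positivity : (0 : ℤ) ≤ c * (m + 1))] at this
    linarith
  have hx1 : 1 ≤ |x| := by nlinarith [(by positivity : (0 : ℤ) ≤ c * (m + 1))]
  have h2 : |x| ≤ |x| ^ m := le_self_pow₀ hx1 (by omega)
  have h3 : |x| ^ 2 ≤ |x| ^ m := pow_le_pow_right₀ hx1 (by omega)
  have h4 := abs_sub_abs_le_abs_sub (x ^ m * (x - c * (m + 1))) (-(c * m : ℤ))
  rw [abs_neg, abs_of_nonneg (by positivity : (0 : ℤ) ≤ c * m), abs_mul, abs_pow,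
    sub_neg_eq_add] at h4
  have h5 : |x| ^ m * 2 ≤ |x| ^ m * |x - c * (m + 1)| :=
    mul_le_mul_of_nonneg_left h1 (by positivity)
  rw [← sq_abs]
  nlinarith [(by positivity : (0 : ℤ) ≤ c)]

theorem four_le_abs_critOrbit_one (hd : 3 ≤ d) (hc : 2 ≤ c) : 4 ≤ |critOrbit c d 1| := by
  rw [critOrbit_one (by omega), ← Nat.cast_mul, Nat.abs_cast]
  exact_mod_cast Nat.mul_le_mul hc (by omega : 2 ≤ d - 1)

theorem critOrbit_growth (hd : 3 ≤ d) (hc : 2 ≤ c) (n : ℕ) (hn : 1 ≤ n) :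
    critOrbit c d n ^ 2 ≤ |critOrbit c d (n + 1)| ∧ (c * d + 2 : ℤ) ≤ |critOrbit c d (n + 1)| := by
  induction n, hn using Nat.le_induction with
  | base =>
    rw [critOrbit_succ 1, critOrbit_one (by omega), eval_critTrinomial (by omega)]
    obtain ⟨m, rfl⟩ := Nat.exists_eq_add_of_le' (by omega : 1 ≤ d)
    simp only [add_tsub_cancel_right]
    push_cast
    have hc' : (2 : ℤ) ≤ c := by exact_mod_cast hc
    have hm' : (2 : ℤ) ≤ m := by exact_mod_cast (by omega : 2 ≤ m)
    have hy : (4 : ℤ) ≤ c * m := by nlinarith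
    have h1 : (c * m : ℤ) ^ 2 ≤ (c * m : ℤ) ^ m := pow_le_pow_right₀ (by linarith) (by omega)
    have h2 : (2 : ℤ) * (c * m) ^ 2 ≤ c * (c * m) ^ m :=
      mul_le_mul hc' h1 (by positivity) (by positivity)
    have h3 : ((c * m : ℤ) ^ m * (c * m - c * (m + 1)) + c * m) = -(c * (c * m) ^ m - c * m) := by
      ring
    rw [h3, abs_neg, abs_of_nonneg (by nlinarith)]
    constructor <;> nlinarith
  | succ n hn ih =>
    have h := le_abs_eval_critTrinomial hd ih.2
    rw [← critOrbit_succ] at h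
    refine ⟨h, ih.2.trans (le_trans ?_ h)⟩
    rw [← sq_abs]
    nlinarith [ih.2, (by positivity : (0 : ℤ) ≤ c * d)]

end critTrinomial

theorem Polynomial.exists_aeval_add_eq_of_derivative_eval_eq_zero {f : ℤ[X]} {a : ℤ}
    (hf : (derivative f).eval a = 0) : ∃ h : ℤ[X], ∀ {A : Type} [CommRing A] (y : A),
      aeval (y + (a : A)) f =
        ((f.eval a : ℤ) : A) + y ^ 2 * (((taylor a f).coeff 2 : ℤ) + y * aeval y h) := by
  refine ⟨(taylor a f).divX.divX.divX, fun {A} _ y ↦ ?_⟩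
  have h0 := divX_mul_X_add (taylor a f)
  have h1 := divX_mul_X_add (taylor a f).divX
  have h2 := divX_mul_X_add (taylor a f).divX.divX
  simp only [coeff_divX, zero_add] at h1 h2
  rw [taylor_coeff_one, hf, map_zero, add_zero] at h1
  rw [taylor_coeff_zero] at h0
  have h3 : aeval (y + (a : A)) f = aeval y (taylor a f) := by
    rw [taylor_apply, aeval_comp]; simp
  rw [h3]
  conv_lhs => rw [← h0, ← h1, ← h2]
  simp only [map_add, map_mul, aeval_X, eq_intCast, map_intCast]
  ring

theorem Polynomial.prod_X_sub_C_dvd_of_nodup {A : Type*} [CommRing A] [IsDomain A] {g : A[X]}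
    (hg : g ≠ 0) {s : Multiset A} (hs : s.Nodup) (h : ∀ r ∈ s, g.IsRoot r) :
    (s.map fun r ↦ X - C r).prod ∣ g := by
  rw [Multiset.prod_X_sub_C_dvd_iff_le_roots hg, Multiset.le_iff_subset hs]
  exact fun r hr ↦ (mem_roots hg).2 (h r hr)

section Collision

variable {O : Type} [CommRing O] [IsDomain O] {f : ℤ[X]} (P : Ideal O)

/-- Congruent distinct roots reduce to a multiple root. -/
theorem aeval_derivative_mk_eq_zero_of_sub_mem (hf : f.map (algebraMap ℤ O) ≠ 0) {r s : O}
    (hr : aeval r f = 0) (hs : aeval s f = 0) (hrs : r ≠ s) (h : r - s ∈ P) :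
    aeval (Ideal.Quotient.mk P r) (derivative f) = 0 := by
  obtain ⟨g, hg⟩ := prod_X_sub_C_dvd_of_nodup hf (s := {r, s}) (by simpa using hrs) (by
    intro x hx
    simp only [Multiset.insert_eq_cons, Multiset.mem_cons, Multiset.mem_singleton] at hx
    rw [IsRoot, eval_map_algebraMap]
    rcases hx with rfl | rfl <;> assumption)
  have h1 : aeval r (derivative f) = (r - s) * g.eval r := by
    rw [← eval_map_algebraMap, ← derivative_map, hg]
    simp [derivative_mul]
  rw [show (Ideal.Quotient.mk P r) = algebraMap O (O ⧸ P) r from rfl, aeval_algebraMap_apply, h1]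
  exact Ideal.Quotient.eq_zero_iff_mem.2 (P.mul_mem_right _ h)

theorem not_three_roots_sub_mem (hf : f.map (algebraMap ℤ O) ≠ 0) {a : ℤ}
    (hU : (((taylor a f).coeff 2 : ℤ) : O) ∉ P) {r s t : O}
    (hr : aeval r f = 0) (hs : aeval s f = 0) (ht : aeval t f = 0) (hrs : r ≠ s) (hrt : r ≠ t)
    (hst : s ≠ t) (hra : r - a ∈ P) (hsa : s - a ∈ P) (hta : t - a ∈ P) : False := by
  obtain ⟨g, hg⟩ := prod_X_sub_C_dvd_of_nodup hf (s := {r, s, t}) (by simp [hrs, hrt, hst]) (by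
    intro x hx
    simp only [Multiset.insert_eq_cons, Multiset.mem_cons, Multiset.mem_singleton] at hx
    rw [IsRoot, eval_map_algebraMap]
    rcases hx with rfl | rfl | rfl <;> assumption)
  have key : ∀ u : O, u - a ∈ P → Ideal.Quotient.mk P u = (a : O ⧸ P) := fun u hu ↦ by
    rw [Ideal.Quotient.eq.2 hu, map_intCast]
  have h1 : f.map (Int.castRingHom (O ⧸ P)) = (X - C (a : O ⧸ P)) ^ 3 *
      g.map (Ideal.Quotient.mk P) := by
    have := congrArg (Polynomial.map (Ideal.Quotient.mk P)) hg
    rw [map_map, Subsingleton.elim ((Ideal.Quotient.mk P).comp _) (Int.castRingHom _)] at this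
    rw [this]
    simp only [Polynomial.map_mul, Multiset.insert_eq_cons, Multiset.map_cons, Multiset.prod_cons,
      Multiset.map_singleton, Multiset.prod_singleton, Polynomial.map_sub, map_X, map_C,
      key r hra, key s hsa, key t hta]
    ring
  have h2 : ((taylor a f).map (Int.castRingHom (O ⧸ P))).coeff 2 = 0 := by
    have : (taylor a f).map (Int.castRingHom (O ⧸ P)) =
        X ^ 3 * taylor (a : O ⧸ P) (g.map (Ideal.Quotient.mk P)) := by
      rw [map_taylor]
      simp only [eq_intCast]
      rw [h1, taylor_mul, taylor_pow, map_sub, taylor_X, taylor_C,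
        add_sub_cancel_right]
    rw [this, coeff_X_pow_mul']
    simp
  rw [coeff_map, eq_intCast] at h2
  apply hU
  rw [← Ideal.Quotient.eq_zero_iff_mem]
  simpa using h2

end Collision

section Inertia

open NumberField

variable {K : Type} [Field K] [NumberField K] [IsGalois ℚ K] {f : ℤ[X]}

/-- A prime of odd multiplicity in `f a`, where `a` is a critical point of `f` and its reduction
is the only (and an ordinary) double root, has an inertia element acting as a transposition. -/
theorem exists_galois_swap_of_odd_factorization (hmonic : f.Monic)
    (hsplit : (f.map (algebraMap ℤ K)).Splits)
    (hfaith : ∀ σ : K ≃ₐ[ℚ] K, (∀ x, aeval x f = 0 → σ x = x) → σ = 1)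
    {p : ℕ} (hp : p.Prime) {a : ℤ} (hder : (derivative f).eval a = 0)
    (hU : ¬ (p : ℤ) ∣ (taylor a f).coeff 2) (hodd : Odd ((f.eval a).natAbs.factorization p))
    (hsep : ∀ (F : Type) [Field F] (x : F), (p : F) = 0 → aeval x f = 0 →
      aeval x (derivative f) = 0 → x = a) :
    ∃ (σ : K ≃ₐ[ℚ] K) (r s : K), r ≠ s ∧ aeval r f = 0 ∧ aeval s f = 0 ∧ σ r = s ∧ σ s = r ∧
      ∀ x, aeval x f = 0 → x ≠ r → x ≠ s → σ x = x := by
  have hp' : Prime (p : ℤ) := Nat.prime_iff_prime_int.1 hp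
  have hfa : f.eval a ≠ 0 := by
    intro h
    simp [h] at hodd
  set v : Ideal ℤ := Ideal.span {(p : ℤ)} with hv
  have hv0 : v ≠ ⊥ := by simpa [hv] using hp.ne_zero
  have hvp : v.IsPrime := (Ideal.span_singleton_prime hp'.ne_zero).2 hp'
  have hvm : v.IsMaximal := hvp.isMaximal hv0
  obtain ⟨P, hPm, hPv⟩ := Ideal.exists_maximal_ideal_liesOver_of_isIntegral v (S := 𝓞 K)
  have hPmem : ∀ z : ℤ, (z : 𝓞 K) ∈ P ↔ (p : ℤ) ∣ z := by
    intro z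
    rw [← Ideal.mem_span_singleton, ← hv, hPv.over, Ideal.mem_comap, eq_intCast]
  have hPp : ((p : ℤ) : 𝓞 K) ∈ P := (hPmem _).2 dvd_rfl
  have hP0 : P ≠ ⊥ := by
    rintro rfl
    rw [Ideal.mem_bot] at hPp
    exact hp.ne_zero (by exact_mod_cast hPp)
  have hf0 : f.map (algebraMap ℤ (𝓞 K)) ≠ 0 := (hmonic.map _).ne_zero
  have hUP : (((taylor a f).coeff 2 : ℤ) : 𝓞 K) ∉ P := by rwa [hPmem]
  have hcoe : ∀ x : 𝓞 K, aeval (x : K) f = 0 ↔ aeval x f = 0 := fun x ↦ by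
    rw [show (x : K) = algebraMap (𝓞 K) K x from rfl, aeval_algebraMap_apply]
    simp
  have hroot : ∀ x : K, aeval x f = 0 → ∃ y : 𝓞 K, (y : K) = x ∧ aeval y f = 0 := by
    intro x hx
    refine ⟨⟨x, f, hmonic, by simpa [aeval_def] using hx⟩, rfl, ?_⟩
    exact (hcoe _).1 hx
  obtain ⟨r, hr, hra⟩ : ∃ r : 𝓞 K, aeval r f = 0 ∧ r - a ∈ P := by
    by_contra! hcon
    have key : ∀ m : Multiset K, (∀ x ∈ m, aeval x f = 0) →
        ∃ z : 𝓞 K, z ∉ P ∧ (z : K) = (m.map fun x ↦ (a : K) - x).prod := by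
      intro m
      induction m using Multiset.induction_on with
      | empty => exact fun _ ↦ ⟨1, (Ideal.ne_top_iff_one P).1 hPm.ne_top, by simp⟩
      | cons x m ih =>
        intro hm
        obtain ⟨z, hz, hzm⟩ := ih fun x hx ↦ hm x (Multiset.mem_cons_of_mem hx)
        obtain ⟨y, rfl, hy⟩ := hroot x (hm x (Multiset.mem_cons_self _ _))
        refine ⟨(a - y) * z, fun h ↦ ?_, by simp [hzm]⟩
        rcases hPm.isPrime.mem_or_mem h with h | h
        · exact hcon y hy (by rw [← neg_sub]; exact P.neg_mem h)
        · exact hz h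
    obtain ⟨z, hz, hzm⟩ := key (f.map (algebraMap ℤ K)).roots fun x hx ↦ by
      rw [← eval_map_algebraMap]
      exact (mem_roots'.1 hx).2
    have h1 : (z : K) = ((f.eval a : ℤ) : K) := by
      have h2 := congrArg (eval (a : K)) (hsplit.eq_prod_roots_of_monic (hmonic.map _))
      rw [eval_multiset_prod, Multiset.map_map] at h2
      simp only [Function.comp_def, eval_sub, eval_X, eval_C] at h2
      rw [hzm, ← h2, eval_intCast_map]
      simp
    have h3 : z = ((f.eval a : ℤ) : 𝓞 K) := by
      apply NumberField.RingOfIntegers.coe_injective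
      exact h1.trans (map_intCast (algebraMap (𝓞 K) K) _).symm
    apply hz
    rw [h3, hPmem, Int.natCast_dvd]
    by_contra h
    rw [Nat.factorization_eq_zero_of_not_dvd h] at hodd
    exact absurd hodd (by decide)
  obtain ⟨σ, hσP, hσ1⟩ : ∃ σ ∈ P.toAddSubgroup.inertia (K ≃ₐ[ℚ] K), σ ≠ 1 := by
    by_contra! hcon
    have he : P.ramificationIdx ℤ = 1 := by
      rw [← Ideal.ramificationIdxIn_eq_ramificationIdx v P (K ≃ₐ[ℚ] K),
        ← Ideal.card_inertia_eq_ramificationIdxIn (G := K ≃ₐ[ℚ] K) v P, Nat.card_eq_one_iff_unique]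
      exact ⟨⟨fun x y ↦ Subtype.ext ((hcon _ x.2).trans (hcon _ y.2).symm)⟩, ⟨1⟩⟩
    obtain ⟨h, hh⟩ := exists_aeval_add_eq_of_derivative_eval_eq_zero hder
    have h1 := hh (r - a)
    rw [sub_add_cancel, hr] at h1
    set y := r - a with hy
    set w := (((taylor a f).coeff 2 : ℤ) : 𝓞 K) + y * aeval y h with hw
    have hwP : w ∉ P := fun hw' ↦ hUP ((P.add_mem_iff_left (P.mul_mem_right _ hra)).1 hw')
    have h2 : ((f.eval a : ℤ) : 𝓞 K) = - (y ^ 2 * w) := eq_neg_of_add_eq_zero_left h1.symm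
    have hPprime : Prime P := Ideal.prime_of_isPrime hP0 hPm.isPrime
    have hvprime : Prime v := Ideal.prime_of_isPrime hv0 hvp
    have h3 := Ideal.IsDedekindDomain.emultiplicity_map_eq_ramificationIdx'_mul
      (I := Ideal.span {f.eval a}) (v := v) (w := P) (by simpa using hfa) hvprime.irreducible
      hPprime.irreducible hP0
    rw [Ideal.map_span, Set.image_singleton, eq_intCast, h2, Ideal.span_singleton_neg,
      ← Ideal.span_singleton_mul_span_singleton, ← Ideal.span_singleton_pow,
      emultiplicity_mul hPprime, emultiplicity_pow hPprime,
      Ideal.ramificationIdx'_eq_ramificationIdx _ _ hv0, he, Nat.cast_one, one_mul] at h3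
    rw [show emultiplicity P (Ideal.span {w}) = 0 from emultiplicity_eq_zero.2 (by
      rwa [Ideal.dvd_span_singleton]), add_zero, hv,
      Ideal.emultiplicity_eq_emultiplicity_span, ← Int.emultiplicity_natAbs,
      (Nat.finiteMultiplicity_iff.2 ⟨hp.ne_one, Int.natAbs_pos.2 hfa⟩).emultiplicity_eq_multiplicity,
      Nat.multiplicity_eq_factorization hp (Int.natAbs_ne_zero.2 hfa)] at h3
    obtain ⟨k, hk⟩ := ENat.ne_top_iff_exists.1 (show emultiplicity P (Ideal.span {y}) ≠ ⊤ by
      intro h4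
      simp [h4] at h3)
    rw [← hk] at h3
    have h5 : 2 * k = (f.eval a).natAbs.factorization p := by exact_mod_cast h3
    rw [← h5] at hodd
    exact (Nat.not_odd_iff_even.2 (even_two_mul k)) hodd
  have hmoved : ∀ x : 𝓞 K, aeval x f = 0 → aeval (σ • x) f = 0 := fun x hx ↦ by
    rw [← hcoe] at hx ⊢
    rw [show ((σ • x : 𝓞 K) : K) = σ.toAlgHom.restrictScalars ℤ (x : K) from rfl,
      aeval_algHom_apply, hx, map_zero]
  have hsub : ∀ x : 𝓞 K, σ • x - x ∈ P := fun x ↦ hσP x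
  have hred : ∀ x : 𝓞 K, aeval x f = 0 → σ • x ≠ x → x - a ∈ P := by
    intro x hx hne
    let _ := Ideal.Quotient.field P
    have h1 := aeval_derivative_mk_eq_zero_of_sub_mem P hf0 hx (hmoved x hx) hne.symm
      (by rw [← neg_sub]; exact P.neg_mem (hsub x))
    have h2 := hsep (𝓞 K ⧸ P) (Ideal.Quotient.mk P x) ?_ ?_ h1
    · rw [← Ideal.Quotient.eq_zero_iff_mem]
      rw [map_sub, h2, map_intCast, sub_self]
    · have := Ideal.Quotient.eq_zero_iff_mem.2 hPp
      simpa using this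
    · rw [show (Ideal.Quotient.mk P x) = algebraMap (𝓞 K) (𝓞 K ⧸ P) x from rfl,
        aeval_algebraMap_apply, hx, map_zero]
  obtain ⟨x, hx, hne⟩ : ∃ x : 𝓞 K, aeval x f = 0 ∧ σ • x ≠ x := by
    by_contra! hcon
    refine hσ1 (hfaith σ fun x hx ↦ ?_)
    obtain ⟨y, rfl, hy⟩ := hroot x hx
    exact congrArg (algebraMap (𝓞 K) K) (hcon y hy)
  have hne' : σ • σ • x ≠ σ • x := fun h ↦ hne (smul_left_cancel σ h)
  have hxP := hred x hx hne
  have hsxP := hred _ (hmoved x hx) hne'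
  have hback : σ • σ • x = x := by
    by_contra hcon
    refine not_three_roots_sub_mem P hf0 hUP hx (hmoved x hx) (hmoved _ (hmoved x hx)) hne.symm
      (Ne.symm hcon) hne'.symm hxP hsxP ?_
    rw [← sub_add_sub_cancel]
    exact P.add_mem (hsub (σ • x)) hsxP
  refine ⟨σ, x, (σ • x : 𝓞 K), fun h ↦ hne (RingOfIntegers.coe_injective h).symm, (hcoe _).2 hx,
    (hcoe _).2 (hmoved x hx), rfl, congrArg (algebraMap (𝓞 K) K) hback, fun y hy hyx hys ↦ ?_⟩
  obtain ⟨y, rfl, hy'⟩ := hroot y hy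
  by_contra hmv
  have hmv' : σ • y ≠ y := fun h ↦ hmv (congrArg (algebraMap (𝓞 K) K) h)
  exact not_three_roots_sub_mem P hf0 hUP hx (hmoved x hx) hy' hne.symm
    (fun h ↦ hyx (by rw [h])) (fun h ↦ hys (by rw [h])) hxP hsxP (hred y hy' hmv')
end Inertia

theorem derivative_polyIter_succ' {R : Type*} [CommRing R] (φ : R[X]) (n : ℕ) :
    derivative (polyIter φ (n + 1)) =
      derivative φ * (derivative (polyIter φ n)).comp φ := by
  rw [polyIter_succ', derivative_comp, mul_comm]

theorem exists_aeval_derivative_eq_zero_of_polyIter {F : Type*} [Field F] {φ : ℤ[X]} {n : ℕ} :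
    ∀ {x : F}, aeval x (derivative (polyIter φ n)) = 0 →
      ∃ k < n, aeval (aeval x (polyIter φ k)) (derivative φ) = 0 := by
  induction n with
  | zero => intro x hx; simp [polyIter_zero] at hx
  | succ n ih =>
    intro x hx
    rw [derivative_polyIter_succ', map_mul, aeval_comp, mul_eq_zero] at hx
    rcases hx with hx | hx
    · exact ⟨0, n.succ_pos, by simpa [polyIter_zero] using hx⟩
    · obtain ⟨k, hk, h⟩ := ih hx
      exact ⟨k + 1, Nat.succ_lt_succ hk, by rwa [aeval_polyIter_succ']⟩

theorem intCast_ne_zero_of_not_dvd {F : Type*} [Ring F] [Nontrivial F] {p : ℕ} (hp : p.Prime)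
    (hpF : (p : F) = 0) {z : ℤ} (hz : ¬ (p : ℤ) ∣ z) : (z : F) ≠ 0 := by
  intro h
  obtain ⟨u, v, huv⟩ := (Nat.prime_iff_prime_int.1 hp).coprime_iff_not_dvd.2 hz
  have := congrArg (Int.cast : ℤ → F) huv
  simp [h, hpF] at this

section Orbit

variable {c d n p : ℕ}

theorem eval_derivative_critTrinomial (hd : 3 ≤ d) (x : ℤ) :
    (derivative (critTrinomial c d)).eval x = d * x ^ (d - 2) * (x - critOrbit c d 1) := by
  rw [derivative_critTrinomial hd, critOrbit_one (by omega)]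
  simp

theorem not_dvd_critOrbit_sub (hprim : ∀ k, 1 ≤ k → k ≤ n → ¬ (p : ℤ) ∣ critOrbit c d k)
    (hdvd : (p : ℤ) ∣ critOrbit c d (n + 1)) {j : ℕ} (hj : 2 ≤ j) (hjn : j ≤ n) :
    ¬ (p : ℤ) ∣ critOrbit c d j - critOrbit c d 1 := by
  intro h
  have h1 := h.trans (sub_dvd_eval_sub _ _ (polyIter (critTrinomial c d) (n + 1 - j)))
  rw [eval_critOrbit, eval_critOrbit, Nat.sub_add_cancel (by omega)] at h1
  exact hprim (n + 1 - j + 1) (by omega) (by omega) ((dvd_sub_right hdvd).1 h1)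

theorem not_dvd_eval_derivative_polyIter (hd : 3 ≤ d) (hp : p.Prime) (hpd : ¬ p ∣ d)
    (hprim : ∀ k, 1 ≤ k → k ≤ n → ¬ (p : ℤ) ∣ critOrbit c d k)
    (hdvd : (p : ℤ) ∣ critOrbit c d (n + 1)) (m : ℕ) :
    ∀ j, 2 ≤ j → j + m ≤ n + 1 →
      ¬ (p : ℤ) ∣ (derivative (polyIter (critTrinomial c d) m)).eval (critOrbit c d j) := by
  have hp' := Nat.prime_iff_prime_int.1 hp
  induction m with
  | zero =>
    intro j _ _ h
    simp only [polyIter_zero, derivative_X, eval_one] at h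
    exact hp'.not_dvd_one h
  | succ m ih =>
    intro j hj hjm
    rw [derivative_polyIter_succ', eval_mul, eval_comp, ← critOrbit_succ,
      eval_derivative_critTrinomial hd]
    intro h
    rcases hp'.dvd_or_dvd h with h | h
    · rcases hp'.dvd_or_dvd h with h | h
      · rcases hp'.dvd_or_dvd h with h | h
        · exact hpd (by exact_mod_cast h)
        · exact hprim j (by omega) (by omega) (hp'.dvd_of_dvd_pow h)
      · exact not_dvd_critOrbit_sub hprim hdvd hj (by omega) h
    · exact ih (j + 1) (by omega) (by omega) h

theorem not_dvd_taylor_coeff_two (hd : 3 ≤ d) (hn : 1 ≤ n) (hp : p.Prime) (hpd : ¬ p ∣ d)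
    (hprim : ∀ k, 1 ≤ k → k ≤ n → ¬ (p : ℤ) ∣ critOrbit c d k)
    (hdvd : (p : ℤ) ∣ critOrbit c d (n + 1)) :
    ¬ (p : ℤ) ∣ (taylor (critOrbit c d 1) (polyIter (critTrinomial c d) n)).coeff 2 := by
  have hp' := Nat.prime_iff_prime_int.1 hp
  obtain ⟨m, rfl⟩ := Nat.exists_eq_add_of_le' hn
  intro h
  have h2 := congrArg (eval (critOrbit c d 1)) (congrFun (factorial_smul_hasseDeriv (R := ℤ) 2)
    (polyIter (critTrinomial c d) (m + 1)))
  have h3 : (derivative^[2] (polyIter (critTrinomial c d) (m + 1))).eval (critOrbit c d 1) =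
      d * critOrbit c d 1 ^ (d - 2) *
        (derivative (polyIter (critTrinomial c d) m)).eval (critOrbit c d 2) := by
    rw [Function.iterate_succ_apply, Function.iterate_one, derivative_polyIter_succ',
      derivative_mul, eval_add, eval_mul, eval_mul, eval_derivative_critTrinomial hd, sub_self,
      mul_zero, zero_mul, add_zero, eval_comp, ← critOrbit_succ, derivative_critTrinomial hd,
      derivative_mul, critOrbit_one (by omega)]
    simp
  rw [h3] at h2
  have h4 : (p : ℤ) ∣ d * critOrbit c d 1 ^ (d - 2) *
      (derivative (polyIter (critTrinomial c d) m)).eval (critOrbit c d 2) := by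
    rw [← h2, LinearMap.smul_apply, eval_smul, ← taylor_coeff]
    rw [nsmul_eq_mul]
    exact h.mul_left _
  rcases hp'.dvd_or_dvd h4 with h | h
  · rcases hp'.dvd_or_dvd h with h | h
    · exact hpd (by exact_mod_cast h)
    · exact hprim 1 le_rfl hn (hp'.dvd_of_dvd_pow h)
  · exact not_dvd_eval_derivative_polyIter hd hp hpd hprim hdvd m 2 le_rfl (by omega) h

theorem eq_critOrbit_one_of_multiple_root (hd : 3 ≤ d) (hp : p.Prime) (hpd : ¬ p ∣ d)
    (hprim : ∀ k, 1 ≤ k → k ≤ n → ¬ (p : ℤ) ∣ critOrbit c d k)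
    {F : Type*} [Field F] {x : F} (hpF : (p : F) = 0)
    (hx : aeval x (polyIter (critTrinomial c d) n) = 0)
    (hx' : aeval x (derivative (polyIter (critTrinomial c d) n)) = 0) :
    x = critOrbit c d 1 := by
  obtain ⟨k, hk, h⟩ := exists_aeval_derivative_eq_zero_of_polyIter hx'
  set y := aeval x (polyIter (critTrinomial c d) k) with hy
  have hxy : aeval y (polyIter (critTrinomial c d) (n - k)) = 0 := by
    rw [hy, ← aeval_comp, ← polyIter_add, Nat.sub_add_cancel hk.le, hx]
  have key : ∀ j : ℕ, y = critOrbit c d j → (critOrbit c d (n - k + j) : F) = 0 := by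
    rintro j hj
    rw [← eval_critOrbit, ← hxy, hj, ← eq_intCast (algebraMap ℤ F) (critOrbit c d j),
      aeval_algebraMap_apply]
    simp
  rw [derivative_critTrinomial hd, map_mul, map_mul, mul_eq_zero, mul_eq_zero] at h
  rcases h with (h | h) | h
  · refine absurd ?_ (intCast_ne_zero_of_not_dvd hp hpF (z := d) (by exact_mod_cast hpd))
    simpa using h
  · have hy0 : y = 0 := by
      simp only [map_pow, aeval_X] at h
      exact pow_eq_zero_iff (by omega) |>.1 h
    refine absurd (key 0 (by simp [hy0, critOrbit_zero])) ?_
    exact intCast_ne_zero_of_not_dvd hp hpF (hprim _ (by omega) (by omega))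
  · have hy1 : y = critOrbit c d 1 := by
      rw [critOrbit_one (by omega)]
      simpa [sub_eq_zero] using h
    rcases Nat.eq_zero_or_pos k with rfl | hk0
    · rw [← hy1, hy, polyIter_zero, aeval_X]
    · refine absurd (key 1 hy1) ?_
      exact intCast_ne_zero_of_not_dvd hp hpF (hprim _ (by omega) (by omega))

theorem exists_galois_swap_critTrinomial {K : Type} [Field K] [NumberField K] [IsGalois ℚ K]
    (hd : 3 ≤ d) (hn : 1 ≤ n)
    (hsplit : ((polyIter (critTrinomial c d) n).map (algebraMap ℤ K)).Splits)
    (hfaith : ∀ σ : K ≃ₐ[ℚ] K,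
      (∀ x, aeval x (polyIter (critTrinomial c d) n) = 0 → σ x = x) → σ = 1)
    (hp : p.Prime) (hpd : ¬ p ∣ d)
    (hprim : ∀ k, 1 ≤ k → k ≤ n → ¬ (p : ℤ) ∣ critOrbit c d k)
    (hodd : Odd ((critOrbit c d (n + 1)).natAbs.factorization p)) :
    ∃ (σ : K ≃ₐ[ℚ] K) (r s : K), r ≠ s ∧ aeval r (polyIter (critTrinomial c d) n) = 0 ∧
      aeval s (polyIter (critTrinomial c d) n) = 0 ∧ σ r = s ∧ σ s = r ∧
      ∀ x, aeval x (polyIter (critTrinomial c d) n) = 0 → x ≠ r → x ≠ s → σ x = x := by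
  have hdvd : (p : ℤ) ∣ critOrbit c d (n + 1) := by
    rw [Int.natCast_dvd]
    by_contra h
    rw [Nat.factorization_eq_zero_of_not_dvd h] at hodd
    exact absurd hodd (by decide)
  refine exists_galois_swap_of_odd_factorization ((critTrinomial_monic (by omega)).polyIter
    (by rw [critTrinomial_natDegree (by omega)]; omega) n) hsplit hfaith hp (a := critOrbit c d 1) ?_
    (not_dvd_taylor_coeff_two hd hn hp hpd hprim hdvd) (by rwa [eval_critOrbit]) ?_
  · obtain ⟨m, rfl⟩ := Nat.exists_eq_add_of_le' hn
    rw [derivative_polyIter_succ', eval_mul, eval_derivative_critTrinomial hd, sub_self, mul_zero,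
      zero_mul]
  · exact fun F _ x hpF hx hx' ↦ eq_critOrbit_one_of_multiple_root hd hp hpd hprim hpF hx hx'

end Orbit

section FiberSwaps

open Equiv

variable {R B : Type*} [DecidableEq R] {π : R → B} {H : Subgroup (Perm R)}

theorem swap_apply_mem_of_mem {x y : R} {h : Perm R} (hh : h ∈ H) (hxy : swap x y ∈ H) :
    swap (h x) (h y) ∈ H := by
  rw [← mul_inv_cancel_right (swap (h x) (h y)) h, ← Equiv.mul_swap_eq_swap_mul]
  exact H.mul_mem (H.mul_mem hh hxy) (H.inv_mem hh)

/-- A transposition preserving a partition without singletons moves points inside one part. -/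
theorem apply_eq_of_swap_mem (hπ : ∀ h ∈ H, ∀ x y, π x = π y → π (h x) = π (h y))
    (hfib : ∀ x, ∃ y, y ≠ x ∧ π y = π x) {x y : R} (hxy : swap x y ∈ H) : π x = π y := by
  by_contra hne
  obtain ⟨t, ht, htx⟩ := hfib x
  have h := hπ _ hxy t x htx
  rw [swap_apply_of_ne_of_ne ht (by rintro rfl; exact hne htx.symm), swap_apply_left] at h
  exact hne (htx.symm.trans h)

theorem mem_of_forall_swap_mem [Fintype R] (hsw : ∀ x y, π x = π y → swap x y ∈ H)
    (h : Perm R) (hh : ∀ x, π (h x) = π x) : h ∈ H := by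
  induction hn : h.support.card using Nat.strong_induction_on generalizing h with
  | _ n ih =>
    by_cases h1 : h = 1
    · exact h1 ▸ H.one_mem
    obtain ⟨x, hx⟩ : ∃ x, h x ≠ x := by
      by_contra! hcon
      exact h1 (Equiv.ext hcon)
    have h2 := hsw x (h x) (hh x).symm
    have h3 : swap x (h x) * h ∈ H := by
      refine ih _ (hn ▸ Perm.card_support_swap_mul hx) _ (fun y ↦ ?_) rfl
      rw [Perm.mul_apply, swap_apply_def]
      split_ifs with h4 h5
      · rw [hh, ← h4, hh]
      · rw [← hh x, ← h5, hh]
      · exact hh y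
    rwa [H.mul_mem_cancel_left h2] at h3

theorem swap_mem_of_prime [Finite R] (hπ : ∀ h ∈ H, ∀ x y, π x = π y → π (h x) = π (h y))
    (htrans : ∀ x y, ∃ h ∈ H, h x = y) {d : ℕ} (hd : d.Prime)
    (hfib : ∀ x, Nat.card {y // π y = π x} = d) {r s : R} (hrs : r ≠ s) (hswap : swap r s ∈ H)
    {x y : R} (hxy : π x = π y) : swap x y ∈ H := by
  classical
  have := Fintype.ofFinite R
  have hfib' : ∀ x, (Finset.univ.filter fun y ↦ π y = π x).card = d := fun x ↦ by
    rw [← hfib x, Nat.card_eq_fintype_card, Fintype.card_subtype]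
  have hne : ∀ x, ∃ y, y ≠ x ∧ π y = π x := by
    intro x
    have h1 := hd.one_lt
    rw [← hfib' x, Finset.one_lt_card] at h1
    obtain ⟨u, hu, v, hv, huv⟩ := h1
    rw [Finset.mem_filter_univ] at hu hv
    by_cases hux : u = x
    · exact ⟨v, fun h ↦ huv (hux.trans h.symm), hv⟩
    · exact ⟨u, hux, hu⟩
  let S : Setoid R :=
    { r := fun x y ↦ swap x y ∈ H
      iseqv :=
        { refl := fun x ↦ by rw [swap_self]; exact H.one_mem
          symm := fun h ↦ by rwa [swap_comm]
          trans := fun h h' ↦ SubmonoidClass.swap_mem_trans H h h' } }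
  let cl : R → Finset R := fun x ↦ Finset.univ.filter fun y ↦ swap x y ∈ H
  have hcl : ∀ x y, y ∈ cl x ↔ swap x y ∈ H := fun x y ↦ Finset.mem_filter_univ _
  have hcard : ∀ x, (cl x).card = (cl r).card := by
    intro x
    obtain ⟨h, hh, rfl⟩ := htrans r x
    refine (Finset.card_bij (fun y _ ↦ h y) (fun y hy ↦ ?_) (fun _ _ _ _ e ↦ h.injective e)
      fun y hy ↦ ?_).symm
    · rw [hcl] at hy ⊢
      exact swap_apply_mem_of_mem hh hy
    · refine ⟨h⁻¹ y, ?_, h.apply_symm_apply y⟩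
      rw [hcl] at hy ⊢
      simpa using swap_apply_mem_of_mem (H.inv_mem hh) hy
  have hdvd : (cl r).card ∣ d := by
    rw [← hfib' x, Finset.card_eq_sum_card_image (Quotient.mk S)
      (Finset.univ.filter fun y ↦ π y = π x)]
    refine Finset.dvd_sum fun q hq ↦ ?_
    obtain ⟨z, hz, rfl⟩ := Finset.mem_image.1 hq
    rw [Finset.mem_filter_univ] at hz
    rw [← hcard z]
    refine dvd_of_eq (congrArg Finset.card ?_)
    ext y
    rw [hcl, Finset.mem_filter, Finset.mem_filter_univ, Quotient.eq]
    refine ⟨fun h ↦ ⟨(apply_eq_of_swap_mem hπ hne h).symm.trans hz, ?_⟩, fun h ↦ ?_⟩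
    · exact S.symm h
    · exact S.symm h.2
  have h1 : (cl r).card ≠ 1 := by
    refine ne_of_gt (Finset.one_lt_card.2 ⟨r, (hcl _ _).2 (S.refl r), s, (hcl _ _).2 hswap, hrs⟩)
  have h2 := (hd.eq_one_or_self_of_dvd _ hdvd).resolve_left h1
  have h3 : cl x = Finset.univ.filter fun y ↦ π y = π x := by
    refine Finset.eq_of_subset_of_card_le (fun y hy ↦ ?_) (by rw [hfib' x, hcard, h2])
    rw [hcl] at hy
    exact (Finset.mem_filter_univ _).2 (apply_eq_of_swap_mem hπ hne hy).symm
  rw [← hcl, h3]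
  exact (Finset.mem_filter_univ _).2 hxy.symm

theorem swap_mem_of_fixed_point (hπ : ∀ h ∈ H, ∀ x y, π x = π y → π (h x) = π (h y))
    (htrans : ∀ x y, ∃ h ∈ H, h x = y) (hne : ∀ x, ∃ y, y ≠ x ∧ π y = π x) {r s : R} (hrs : r ≠ s)
    (hswap : swap r s ∈ H) {α : R} (hα : ∀ x y, π x = π α → π y = π α → x ≠ α → y ≠ α →
      ∃ h ∈ H, h α = α ∧ h x = y) {x y : R} (hxy : π x = π y) : swap x y ∈ H := by
  have key : ∀ y, π y = π α → swap α y ∈ H := by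
    intro y hy
    by_cases hyα : y = α
    · rw [hyα, swap_self]; exact H.one_mem
    obtain ⟨h, hh, hr⟩ := htrans r α
    have h1 := swap_apply_mem_of_mem hh hswap
    rw [hr] at h1
    obtain ⟨h', hh', h2, h3⟩ := hα (h s) y (apply_eq_of_swap_mem hπ hne h1).symm hy
      (fun e ↦ hrs (h.injective (hr.trans e.symm))) hyα
    have h4 := swap_apply_mem_of_mem hh' h1
    rwa [h2, h3] at h4
  obtain ⟨h, hh, hx⟩ := htrans α x
  have h1 := hπ _ (H.inv_mem hh) _ _ hxy
  have h2 : h⁻¹ x = α := by rw [← hx]; exact h.symm_apply_apply α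
  rw [h2] at h1
  have h3 := swap_apply_mem_of_mem hh (key _ h1.symm)
  simpa [hx] using h3

end FiberSwaps

section Roots

variable {K : Type*} [Field K] {φ f g : ℤ[X]}

theorem card_aeval_eq_zero (hf : f.Monic) (hsplit : (f.map (algebraMap ℤ K)).Splits)
    (hsep : (f.map (algebraMap ℤ K)).Separable) :
    Nat.card {x : K // aeval x f = 0} = f.natDegree := by
  classical
  rw [Nat.subtype_card (f.map (algebraMap ℤ K)).roots.toFinset fun x ↦ by
    rw [Multiset.mem_toFinset, mem_roots (hf.map _).ne_zero, IsRoot, eval_map_algebraMap],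
    Multiset.toFinset_card_of_nodup (nodup_roots hsep), ← hsplit.natDegree_eq_card_roots,
    hf.natDegree_map]

theorem card_aeval_eq_of_comp (hf : f.Monic) (hdeg : f.natDegree ≠ 0) (hg : g.Monic)
    (hsplit : ((g.comp f).map (algebraMap ℤ K)).Splits)
    (hsep : ((g.comp f).map (algebraMap ℤ K)).Separable) {β : K} (hβ : aeval β g = 0) :
    Nat.card {x : K // aeval x f = β} = f.natDegree := by
  classical
  have hm : (f.map (algebraMap ℤ K) - C β).Monic := by
    refine (hf.map _).sub_of_left (degree_C_le.trans_lt ?_)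
    rw [hf.degree_map]
    exact natDegree_pos_iff_degree_pos.1 (Nat.pos_of_ne_zero hdeg)
  have hdvd : f.map (algebraMap ℤ K) - C β ∣ (g.comp f).map (algebraMap ℤ K) := by
    rw [map_comp]
    obtain ⟨q, hq⟩ := dvd_iff_isRoot.2 (show (g.map (algebraMap ℤ K)).IsRoot β by
      rwa [IsRoot, eval_map_algebraMap])
    rw [hq, mul_comp, sub_comp, X_comp, C_comp]
    exact dvd_mul_right _ _
  rw [Nat.subtype_card (f.map (algebraMap ℤ K) - C β).roots.toFinset fun x ↦ by
    rw [Multiset.mem_toFinset, mem_roots hm.ne_zero, IsRoot, eval_sub, eval_C,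
      eval_map_algebraMap, sub_eq_zero],
    Multiset.toFinset_card_of_nodup (nodup_roots (hsep.of_dvd hdvd)),
    ← (hsplit.of_dvd ((hg.comp hf hdeg).map _).ne_zero hdvd).natDegree_eq_card_roots,
    natDegree_sub_C, hf.natDegree_map]

end Roots

/-- The action of a Galois group on the roots of an integer polynomial. -/
def galRootPerm (K : Type*) [Field K] [Algebra ℚ K] (f : ℤ[X]) :
    (K ≃ₐ[ℚ] K) →* Equiv.Perm {x : K // aeval x f = 0} where
  toFun σ := σ.toEquiv.subtypeEquiv fun x ↦ by
    change _ ↔ aeval (σ.toAlgHom.restrictScalars ℤ x) f = 0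
    rw [aeval_algHom_apply]
    exact (map_eq_zero σ).symm
  map_one' := rfl
  map_mul' _ _ := rfl

section

variable {K : Type*} [Field K] [Algebra ℚ K] {f : ℤ[X]}

@[simp] theorem coe_galRootPerm (σ : K ≃ₐ[ℚ] K) (x : {x : K // aeval x f = 0}) :
    (galRootPerm K f σ x : K) = σ x := rfl

theorem aeval_algEquiv_apply (σ : K ≃ₐ[ℚ] K) (x : K) (g : ℤ[X]) :
    aeval (σ x) g = σ (aeval x g) :=
  aeval_algHom_apply (σ.toAlgHom.restrictScalars ℤ) x g

end

theorem card_galois_fixing_aeval_eq {K : Type*} [Field K] [Algebra ℚ K] [Normal ℚ K]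
    {φ : ℤ[X]} (hφ : φ.Monic) {n : ℕ} (hd : 3 ≤ φ.natDegree)
    (hirr : Irreducible ((polyIter φ (n + 1)).map (algebraMap ℤ ℚ)))
    (hsplit : ((polyIter φ (n + 1)).map (algebraMap ℤ K)).Splits)
    (hfaith : ∀ σ : K ≃ₐ[ℚ] K, (∀ x, aeval x (polyIter φ (n + 1)) = 0 → σ x = x) → σ = 1)
    (hswap : ∃ (σ : K ≃ₐ[ℚ] K) (r s : K), r ≠ s ∧ aeval r (polyIter φ (n + 1)) = 0 ∧
      aeval s (polyIter φ (n + 1)) = 0 ∧ σ r = s ∧ σ s = r ∧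
      ∀ x, aeval x (polyIter φ (n + 1)) = 0 → x ≠ r → x ≠ s → σ x = x)
    (hcase : φ.natDegree.Prime ∨ ∃ α : K, aeval α (polyIter φ (n + 1)) = 0 ∧
      ∀ x y, aeval x φ = aeval α φ → aeval y φ = aeval α φ → x ≠ α → y ≠ α →
        ∃ σ : K ≃ₐ[ℚ] K, σ α = α ∧ σ x = y) :
    Nat.card {σ : K ≃ₐ[ℚ] K // ∀ x, aeval x (polyIter φ (n + 1)) = 0 →
      aeval (σ x) φ = aeval x φ} = φ.natDegree.factorial ^ φ.natDegree ^ n := by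
  classical
  have hφ0 : φ.natDegree ≠ 0 := by omega
  have hmon : ∀ k, (polyIter φ k).Monic := hφ.polyIter hφ0
  have hsepQ := hirr.separable
  have hsep : ((polyIter φ (n + 1)).map (algebraMap ℤ K)).Separable := by
    have := hsepQ.map (f := algebraMap ℚ K)
    rwa [map_map, ← IsScalarTower.algebraMap_eq] at this
  set f := polyIter φ (n + 1) with hf
  set R := {x : K // aeval x f = 0}
  set B := {x : K // aeval x (polyIter φ n) = 0}
  have hfin : ∀ {g : ℤ[X]}, g.Monic → Finite {x : K // aeval x g = 0} := fun {g} hg ↦ by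
    have : {x : K | aeval x g = 0}.Finite := by
      refine (g.map (algebraMap ℤ K)).roots.toFinset.finite_toSet.subset fun x hx ↦ ?_
      rw [Finset.mem_coe, Multiset.mem_toFinset, mem_roots (hg.map _).ne_zero, IsRoot,
        eval_map_algebraMap]
      exact hx
    exact this.to_subtype
  have : Finite R := hfin (hmon _)
  have : Finite B := hfin (hmon _)
  have := Fintype.ofFinite R
  have := Fintype.ofFinite B
  let π : R → B := fun x ↦ ⟨aeval (x : K) φ, by rw [← aeval_polyIter_succ']; exact x.2⟩
  have hπeq : ∀ x y : R, π x = π y ↔ aeval (x : K) φ = aeval (y : K) φ := fun x y ↦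
    Subtype.ext_iff
  have hfib : ∀ β : B, Nat.card {x : R // π x = β} = φ.natDegree := by
    intro β
    rw [← card_aeval_eq_of_comp hφ hφ0 (hmon n) (K := K) (by rwa [← polyIter_succ'])
      (by rwa [← polyIter_succ']) β.2]
    refine Nat.card_congr ⟨fun x ↦ ⟨x, congrArg Subtype.val x.2⟩,
      fun x ↦ ⟨⟨x, ?_⟩, Subtype.ext x.2⟩, fun _ ↦ rfl, fun _ ↦ rfl⟩
    rw [hf, aeval_polyIter_succ', x.2, β.2]
  set H := (galRootPerm K f).range
  have hπH : ∀ h ∈ H, ∀ x y, π x = π y → π (h x) = π (h y) := by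
    rintro _ ⟨σ, rfl⟩ x y hxy
    rw [hπeq] at hxy ⊢
    simp only [coe_galRootPerm, aeval_algEquiv_apply, hxy]
  have htrans : ∀ x y, ∃ h ∈ H, h x = y := by
    intro x y
    have hmin : ∀ z : R, f.map (algebraMap ℤ ℚ) = minpoly ℚ (z : K) := fun z ↦
      minpoly.eq_of_irreducible_of_monic hirr (by rw [aeval_map_algebraMap]; exact z.2)
        ((hmon _).map _)
    obtain ⟨σ, hσ⟩ := (isConjRoot_iff_exists_algEquiv (K := ℚ) (x := (y : K)) (y := x)).1
      ((hmin y).symm.trans (hmin x))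
    exact ⟨_, ⟨σ, rfl⟩, Subtype.ext hσ⟩
  obtain ⟨σ, r, s, hrs, hr, hs, hσr, hσs, hσ⟩ := hswap
  have hswH : Equiv.swap (⟨r, hr⟩ : R) ⟨s, hs⟩ ∈ H := by
    refine ⟨σ, Equiv.ext fun x ↦ Subtype.ext ?_⟩
    rw [coe_galRootPerm, Equiv.swap_apply_def]
    split_ifs with h1 h2
    · rw [h1]; exact hσr
    · rw [h2]; exact hσs
    · exact hσ x x.2 (fun h ↦ h1 (Subtype.ext h)) (fun h ↦ h2 (Subtype.ext h))
  have hrs' : (⟨r, hr⟩ : R) ≠ ⟨s, hs⟩ := fun h ↦ hrs (congrArg Subtype.val h)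
  have hallsw : ∀ x y, π x = π y → Equiv.swap x y ∈ H := by
    intro x y hxy
    rcases hcase with hprime | ⟨α, hα, hαH⟩
    · exact swap_mem_of_prime hπH htrans hprime (fun x ↦ hfib (π x)) hrs' hswH hxy
    · refine swap_mem_of_fixed_point hπH htrans (fun x ↦ ?_) hrs' hswH (α := ⟨α, hα⟩) ?_ hxy
      · have h1 : 1 < Nat.card {y : R // π y = π x} := by rw [hfib]; omega
        have := Finite.one_lt_card_iff_nontrivial.1 h1
        obtain ⟨y, hy⟩ := exists_ne (⟨x, rfl⟩ : {y : R // π y = π x})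
        exact ⟨y, fun h ↦ hy (Subtype.ext h), y.2⟩
      · intro x y hx hy hxα hyα
        rw [hπeq] at hx hy
        obtain ⟨σ, h1, h2⟩ := hαH x y hx hy (fun h ↦ hxα (Subtype.ext h))
          (fun h ↦ hyα (Subtype.ext h))
        exact ⟨_, ⟨σ, rfl⟩, Subtype.ext h1, Subtype.ext h2⟩
  have hcardB : Fintype.card B = φ.natDegree ^ n := by
    have h1 : Nat.card R = φ.natDegree ^ (n + 1) := by
      rw [card_aeval_eq_zero (hmon _) hsplit hsep, polyIter_natDegree]
    rw [← Nat.card_congr (Equiv.sigmaFiberEquiv π), Nat.card_sigma] at h1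
    simp only [hfib, Finset.sum_const, smul_eq_mul, pow_succ, Finset.card_univ] at h1
    exact Nat.eq_of_mul_eq_mul_right (by omega) h1
  have hcard := DomMulAct.stabilizer_card π
  simp only [← Nat.card_eq_fintype_card, hfib, Finset.prod_const, Finset.card_univ] at hcard
  rw [Nat.card_eq_fintype_card (α := B), hcardB] at hcard
  rw [← hcard]
  refine Nat.card_congr (Equiv.ofBijective
    (fun σ ↦ ⟨galRootPerm K f σ.1, funext fun x ↦ (hπeq _ _).2 (σ.2 x x.2)⟩) ⟨?_, ?_⟩)
  · intro σ τ h
    refine Subtype.ext (inv_mul_eq_one.1 (hfaith _ fun x hx ↦ ?_))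
    have h1 : σ.1 x = τ.1 x := congrArg Subtype.val (congrArg (fun e ↦ e.1 ⟨x, hx⟩) h)
    rw [AlgEquiv.mul_apply, ← h1]
    exact σ.1.symm_apply_apply x
  · rintro ⟨h, hh⟩
    obtain ⟨σ, hσ⟩ := mem_of_forall_swap_mem hallsw h (congrFun hh)
    refine ⟨⟨σ, fun x hx ↦ ?_⟩, Subtype.ext hσ⟩
    have := congrFun hh ⟨x, hx⟩
    rw [← hσ] at this
    exact (hπeq _ _).1 this

section SplittingField

variable {K : Type*} [Field K] [Algebra ℚ K] {φ f : ℤ[X]} {n : ℕ}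

theorem splits_map_of_isSplittingField [h : IsSplittingField ℚ K (f.map (algebraMap ℤ ℚ))] :
    (f.map (algebraMap ℤ K)).Splits := by
  have := h.splits
  rwa [map_map, ← IsScalarTower.algebraMap_eq] at this

theorem eq_one_of_forall_root [h : IsSplittingField ℚ K (f.map (algebraMap ℤ ℚ))]
    (σ : K ≃ₐ[ℚ] K) (hσ : ∀ x, aeval x f = 0 → σ x = x) : σ = 1 := by
  have h2 : σ.toAlgHom = AlgHom.id ℚ _ :=
    AlgHom.ext_of_adjoin_eq_top h.adjoin_rootSet fun x hx ↦ hσ x (by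
      rw [mem_rootSet, aeval_map_algebraMap] at hx
      exact hx.2)
  ext1 x
  exact DFunLike.congr_fun h2 x

theorem mem_Kfield_of_aeval_eq_zero (hφ : (polyIter φ n).Monic) {x : AlgebraicClosure ℚ}
    (hx : aeval x (polyIter φ n) = 0) : x ∈ Kfield φ n :=
  IntermediateField.subset_adjoin _ _ (mem_rootSet.2 ⟨hφ.ne_zero, hx⟩)

theorem isSplittingField_Kfield :
    IsSplittingField ℚ (Kfield φ n) ((polyIter φ n).map (algebraMap ℤ ℚ)) := by
  rw [show Kfield φ n = IntermediateField.adjoin ℚ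
    (((polyIter φ n).map (algebraMap ℤ ℚ)).rootSet (AlgebraicClosure ℚ)) by
    rw [Kfield, rootSet, rootSet, aroots_map]]
  exact IntermediateField.adjoin_rootSet_isSplittingField (IsAlgClosed.splits _)

theorem fixes_Kfield_iff (hφ : φ.Monic) (hd : φ.natDegree ≠ 0) (ι : K →ₐ[ℚ] AlgebraicClosure ℚ)
    (hι : ι.fieldRange = Kfield φ (n + 1)) (σ : K ≃ₐ[ℚ] K) :
    (∀ y, ι y ∈ Kfield φ n → σ y = y) ↔
      ∀ x, aeval x (polyIter φ (n + 1)) = 0 → aeval (σ x) φ = aeval x φ := by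
  have hcoe : ∀ (x : K) (g : ℤ[X]), aeval (ι x) g = ι (aeval x g) :=
    fun x g ↦ aeval_algHom_apply (ι.restrictScalars ℤ) x g
  constructor
  · intro h x hx
    rw [aeval_algEquiv_apply]
    refine h _ (mem_Kfield_of_aeval_eq_zero (hφ.polyIter hd n) ?_)
    rw [hcoe, ← aeval_polyIter_succ', hx, map_zero]
  · intro h
    set F := (IntermediateField.fixedField (Subgroup.zpowers σ)).map ι
    have hF : Kfield φ n ≤ F := by
      refine IntermediateField.adjoin_le_iff.2 fun β hβ ↦ ?_
      rw [mem_rootSet] at hβ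
      have hdeg : 0 < (φ.map (algebraMap ℤ (AlgebraicClosure ℚ))).degree := by
        rw [hφ.degree_map]
        exact natDegree_pos_iff_degree_pos.1 (Nat.pos_of_ne_zero hd)
      obtain ⟨x, hx⟩ := IsAlgClosed.exists_root
        (φ.map (algebraMap ℤ (AlgebraicClosure ℚ)) - C β) (by
          rw [degree_sub_C hdeg]
          exact hdeg.ne')
      rw [IsRoot, eval_sub, eval_C, eval_map_algebraMap, sub_eq_zero] at hx
      have hx' : aeval x (polyIter φ (n + 1)) = 0 := by rw [aeval_polyIter_succ', hx, hβ.2]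
      have hxK := mem_Kfield_of_aeval_eq_zero (hφ.polyIter hd _) hx'
      rw [← hι] at hxK
      obtain ⟨y, rfl⟩ := AlgHom.mem_fieldRange.1 hxK
      rw [hcoe, map_eq_zero] at hx'
      rw [hcoe] at hx
      refine IntermediateField.mem_map _ |>.2 ⟨aeval y φ, ?_, hx⟩
      rw [IntermediateField.mem_fixedField_iff]
      have h1 : Subgroup.zpowers σ ≤ MulAction.stabilizer _ (aeval y φ) := by
        rw [Subgroup.zpowers_le, MulAction.mem_stabilizer_iff]
        exact (aeval_algEquiv_apply σ y φ).symm.trans (h y hx')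
      exact fun τ hτ ↦ h1 hτ
    intro x hx
    obtain ⟨y, hy, hyx⟩ := (IntermediateField.mem_map _).1 (hF hx)
    rw [ι.injective hyx] at hy
    exact (IntermediateField.mem_fixedField_iff _ _).1 hy σ (Subgroup.mem_zpowers σ)

theorem card_fixing_Kfield_eq [IsSplittingField ℚ K ((polyIter φ (n + 1)).map (algebraMap ℤ ℚ))]
    (hφ : φ.Monic) (hd : 3 ≤ φ.natDegree) (ι : K →ₐ[ℚ] AlgebraicClosure ℚ)
    (hι : ι.fieldRange = Kfield φ (n + 1))
    (hirr : Irreducible ((polyIter φ (n + 1)).map (algebraMap ℤ ℚ)))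
    (hswap : ∃ (σ : K ≃ₐ[ℚ] K) (r s : K), r ≠ s ∧ aeval r (polyIter φ (n + 1)) = 0 ∧
      aeval s (polyIter φ (n + 1)) = 0 ∧ σ r = s ∧ σ s = r ∧
      ∀ x, aeval x (polyIter φ (n + 1)) = 0 → x ≠ r → x ≠ s → σ x = x)
    (hcase : φ.natDegree.Prime ∨ ∃ α : K, aeval α (polyIter φ (n + 1)) = 0 ∧
      ∀ x y, aeval x φ = aeval α φ → aeval y φ = aeval α φ → x ≠ α → y ≠ α →
        ∃ σ : K ≃ₐ[ℚ] K, σ α = α ∧ σ x = y) :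
    Nat.card {σ : K ≃ₐ[ℚ] K // ∀ y, ι y ∈ Kfield φ n → σ y = y} =
      φ.natDegree.factorial ^ φ.natDegree ^ n := by
  have := Normal.of_isSplittingField (F := ℚ) (E := K)
    ((polyIter φ (n + 1)).map (algebraMap ℤ ℚ))
  rw [← card_galois_fixing_aeval_eq hφ hd hirr splits_map_of_isSplittingField
    eq_one_of_forall_root hswap hcase]
  exact Nat.card_congr (Equiv.subtypeEquivRight fun σ ↦ fixes_Kfield_iff hφ (by omega) ι hι σ)

theorem relGalCard_succ : relGalCard φ (n + 1) =
    Nat.card {σ : Kfield φ (n + 1) ≃ₐ[ℚ] Kfield φ (n + 1) //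
      ∀ y, (Kfield φ (n + 1)).val y ∈ Kfield φ n → σ y = y} :=
  Nat.card_congr (Equiv.subtypeEquivRight fun _ ↦
    ⟨fun h y hy ↦ h y hy y.2, fun h x hx hx' ↦ h ⟨x, hx'⟩ hx⟩)

end SplittingField

theorem critTrinomial_sub_C_monic {L : Type*} [Field L] {c d : ℕ} (hd : 3 ≤ d) (β : L) :
    ((critTrinomial c d).map (algebraMap ℤ L) - C β).Monic ∧
    ((critTrinomial c d).map (algebraMap ℤ L) - C β).natDegree = d := by
  have hm := critTrinomial_monic (c := c) (d := d) (by omega)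
  have hdeg := critTrinomial_natDegree (c := c) (d := d) (by omega)
  refine ⟨(hm.map _).sub_of_left (degree_C_le.trans_lt ?_), ?_⟩
  · rw [hm.degree_map]
    exact natDegree_pos_iff_degree_pos.1 (by omega)
  · rw [natDegree_sub_C, hm.natDegree_map, hdeg]

theorem mem_roots_critTrinomial_sub_C {L : Type*} [Field L] {c d : ℕ} (hd : 3 ≤ d) {x β : L} :
    x ∈ ((critTrinomial c d).map (algebraMap ℤ L) - C β).roots ↔
      aeval x (critTrinomial c d) = β := by
  rw [mem_roots (critTrinomial_sub_C_monic hd β).1.ne_zero, IsRoot, eval_sub, eval_C,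
    eval_map_algebraMap, sub_eq_zero]

theorem finite_aeval_polyIter_critTrinomial_eq_zero {L : Type*} [Field L] {c d : ℕ}
    (hd : 3 ≤ d) (n : ℕ) : {x : L | aeval x (polyIter (critTrinomial c d) n) = 0}.Finite := by
  have hm := critTrinomial_monic (c := c) (d := d) (by omega)
  have hdeg := critTrinomial_natDegree (c := c) (d := d) (by omega)
  have h := finite_setOfPred_isRoot ((hm.polyIter (by omega) n).map (algebraMap ℤ L)).ne_zero
  simpa only [IsRoot, eval_map_algebraMap] using h

section SmallRoots

variable {L : Type*} [NormedField L] [IsUltrametricDist L] {c d n : ℕ}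

theorem norm_sub_eq_of_lt {a b : L} (h : ‖a‖ < ‖b‖) : ‖a - b‖ = ‖b‖ := by
  rw [sub_eq_add_neg, IsUltrametricDist.norm_add_eq_max_of_norm_ne_norm
    (by rw [norm_neg]; exact h.ne), norm_neg, max_eq_right h.le]

theorem norm_sub_lt_of_lt {a b : L} {r : ℝ} (ha : ‖a‖ < r) (hb : ‖b‖ < r) : ‖a - b‖ < r := by
  rw [sub_eq_add_neg]
  exact (IsUltrametricDist.norm_add_le_max _ _).trans_lt (max_lt ha (by rwa [norm_neg]))

theorem norm_pow_sub_pow_le {x y : L} (hx : ‖x‖ ≤ 1) (hy : ‖y‖ ≤ 1) (m : ℕ) :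
    ‖x ^ m - y ^ m‖ ≤ ‖x - y‖ := by
  rw [← (Commute.all x y).geom_sum₂_mul, norm_mul]
  refine mul_le_of_le_one_left (norm_nonneg _) ?_
  refine IsUltrametricDist.norm_sum_le_of_forall_le_of_nonneg zero_le_one fun i _ ↦ ?_
  rw [norm_mul, norm_pow, norm_pow]
  exact mul_le_one₀ (pow_le_one₀ (norm_nonneg _) hx) (by positivity)
    (pow_le_one₀ (norm_nonneg _) hy)

variable (hd : 3 ≤ d) (hcL : ‖(c : L)‖ = 1) (hdL : ‖(d : L)‖ = 1) (hdL' : ‖((d - 1 : ℕ) : L)‖ < 1)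
include hd hcL hdL

theorem norm_pow_eq_norm_aeval_critTrinomial_sub {x : L} (hx : ‖x‖ < 1) :
    ‖x‖ ^ (d - 1) = ‖aeval x (critTrinomial c d) - c * ((d - 1 : ℕ) : L)‖ := by
  have h : ‖(c * d : L)‖ = 1 := by rw [norm_mul, hcL, hdL, one_mul]
  rw [aeval_critTrinomial (by omega), add_sub_cancel_right, norm_mul, norm_pow,
    norm_sub_eq_of_lt (hx.trans_eq h.symm), h, mul_one]

include hdL'

theorem norm_aeval_critTrinomial_lt_one {x : L} (hx : ‖x‖ < 1) :
    ‖aeval x (critTrinomial c d)‖ < 1 := by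
  have h := norm_pow_eq_norm_aeval_critTrinomial_sub hd hcL hdL hx
  rw [← sub_zero (aeval x _), ← sub_self (c * ((d - 1 : ℕ) : L)), sub_sub_eq_add_sub,
    add_sub_right_comm]
  refine (IsUltrametricDist.norm_add_le_max _ _).trans_lt (max_lt ?_ ?_)
  · rw [← h]
    exact pow_lt_one₀ (norm_nonneg _) hx (by omega)
  · rwa [norm_mul, hcL, one_mul]

theorem norm_eq_one_and_norm_sub_lt_one {x : L} (hx : 1 ≤ ‖x‖)
    (hφ : ‖aeval x (critTrinomial c d)‖ < 1) : ‖x‖ = 1 ∧ ‖x - c * d‖ < 1 := by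
  have h : ‖(c * d : L)‖ = 1 := by rw [norm_mul, hcL, hdL, one_mul]
  have h' : ‖(c * ((d - 1 : ℕ) : L))‖ < 1 := by rwa [norm_mul, hcL, one_mul]
  have h2 := norm_sub_lt_of_lt hφ h'
  rw [aeval_critTrinomial (by omega), add_sub_cancel_right, norm_mul, norm_pow] at h2
  have h3 : ‖x - c * d‖ < 1 :=
    (le_mul_of_one_le_left (norm_nonneg _) (one_le_pow₀ hx)).trans_lt h2
  refine ⟨?_, h3⟩
  rw [norm_sub_rev] at h3
  rw [← norm_sub_eq_of_lt (h3.trans_eq h.symm), sub_sub_cancel_left, norm_neg] at h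
  exact h

theorem eq_of_aeval_critTrinomial_eq_of_one_le_norm {x y : L} (hx : 1 ≤ ‖x‖) (hy : 1 ≤ ‖y‖)
    (hxy : aeval x (critTrinomial c d) = aeval y (critTrinomial c d))
    (hφ : ‖aeval x (critTrinomial c d)‖ < 1) : x = y := by
  obtain ⟨hx1, -⟩ := norm_eq_one_and_norm_sub_lt_one hd hcL hdL hdL' hx hφ
  obtain ⟨hy1, hy2⟩ := norm_eq_one_and_norm_sub_lt_one hd hcL hdL hdL' hy (hxy ▸ hφ)
  rw [aeval_critTrinomial (by omega), aeval_critTrinomial (by omega)] at hxy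
  have h : x ^ (d - 1) * (x - y) = - ((x ^ (d - 1) - y ^ (d - 1)) * (y - c * d)) := by
    linear_combination hxy
  by_contra! hne
  have h2 := congrArg norm h
  rw [norm_mul, norm_pow, hx1, one_pow, one_mul, norm_neg, norm_mul] at h2
  have h3 : 0 < ‖x - y‖ := norm_pos_iff.2 (sub_ne_zero.2 hne)
  have h4 := mul_le_mul_of_nonneg_right (norm_pow_sub_pow_le hx1.le hy1.le (d - 1))
    (norm_nonneg (y - c * d))
  nlinarith

variable [IsAlgClosed L]

theorem exists_aeval_critTrinomial_eq_norm_lt_one {β : L} (hβ : ‖β‖ < 1) :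
    ∃ x, aeval x (critTrinomial c d) = β ∧ ‖x‖ < 1 := by
  obtain ⟨hm, hdeg⟩ := critTrinomial_sub_C_monic (c := c) hd β
  by_contra! hall
  have hprod := (IsAlgClosed.splits _).eval_eq_prod_roots_of_monic hm 0
  have h1 : 1 ≤ ‖(((critTrinomial c d).map (algebraMap ℤ L) - C β).roots.map (0 - ·)).prod‖ := by
    refine Multiset.prod_induction (1 ≤ ‖·‖) _ (fun a b ha hb ↦ ?_) (by simp) fun a ha ↦ ?_
    · rw [norm_mul]
      exact one_le_mul_of_one_le_of_one_le ha hb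
    · obtain ⟨x, hx, rfl⟩ := Multiset.mem_map.1 ha
      rw [zero_sub, norm_neg]
      exact hall x ((mem_roots_critTrinomial_sub_C hd).1 hx)
  rw [← hprod, eval_sub, eval_C, eval_map_algebraMap] at h1
  exact h1.not_gt (norm_sub_lt_of_lt
    (norm_aeval_critTrinomial_lt_one hd hcL hdL hdL' (by simp)) hβ)

omit hdL' in
theorem exists_aeval_critTrinomial_eq_one_le_norm (β : L) :
    ∃ x, aeval x (critTrinomial c d) = β ∧ 1 ≤ ‖x‖ := by
  obtain ⟨hm, hdeg⟩ := critTrinomial_sub_C_monic (c := c) hd β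
  by_contra! hall
  have hsum := (IsAlgClosed.splits _).nextCoeff_eq_neg_sum_roots_of_monic hm
  have h1 : ‖((critTrinomial c d).map (algebraMap ℤ L) - C β).roots.sum‖ < 1 := by
    refine Multiset.sum_induction (‖·‖ < 1) _ (fun a b ha hb ↦ ?_) (by simp) fun a ha ↦ ?_
    · exact (IsUltrametricDist.norm_add_le_max _ _).trans_lt (max_lt ha hb)
    · exact hall a ((mem_roots_critTrinomial_sub_C hd).1 ha)
  rw [← norm_neg, ← hsum, nextCoeff_of_natDegree_pos (by omega), hdeg, coeff_sub, coeff_map,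
    coeff_C, if_neg (by omega), critTrinomial] at h1
  rw [coeff_add, coeff_sub, coeff_X_pow, coeff_C_mul_X_pow, coeff_C, if_neg (by omega),
    if_pos rfl, if_neg (by omega)] at h1
  simp [hcL, hdL] at h1

theorem exists_small_root_polyIter (n : ℕ) :
    ∃ x : L, aeval x (polyIter (critTrinomial c d) n) = 0 ∧ ‖x‖ < 1 := by
  induction n with
  | zero => exact ⟨0, by simp⟩
  | succ n ih =>
    obtain ⟨β, hβ, hβ1⟩ := ih
    obtain ⟨x, hx, hx1⟩ := exists_aeval_critTrinomial_eq_norm_lt_one (c := c) hd hcL hdL hdL' hβ1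
    exact ⟨x, by rw [aeval_polyIter_succ', hx, hβ], hx1⟩

theorem ncard_small_roots_polyIter_le (n : ℕ) :
    {x : L | aeval x (polyIter (critTrinomial c d) n) = 0 ∧ ‖x‖ < 1}.ncard ≤ (d - 1) ^ n := by
  classical
  have hfin : ∀ n, {x : L | aeval x (polyIter (critTrinomial c d) n) = 0 ∧ ‖x‖ < 1}.Finite :=
    fun n ↦ (finite_aeval_polyIter_critTrinomial_eq_zero (c := c) hd n).subset fun x hx ↦ hx.1
  induction n with
  | zero =>
    refine (Set.ncard_le_ncard (t := {0}) fun x hx ↦ ?_).trans (by simp)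
    simpa using hx.1
  | succ n ih =>
    rw [Set.ncard_eq_toFinset_card _ (hfin _)] at ih ⊢
    rw [pow_succ']
    refine le_trans (Finset.card_le_mul_card_image (f := fun x ↦ aeval x (critTrinomial c d)) _
      (d - 1) fun β hβ ↦ ?_) (Nat.mul_le_mul_left _ ((Finset.card_le_card ?_).trans ih))
    · obtain ⟨y, hy, hy1⟩ := exists_aeval_critTrinomial_eq_one_le_norm (c := c) hd hcL hdL β
      have hsub : insert y {x ∈ (hfin (n + 1)).toFinset | aeval x (critTrinomial c d) = β} ⊆
          ((critTrinomial c d).map (algebraMap ℤ L) - C β).roots.toFinset := by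
        intro x hx
        rw [Multiset.mem_toFinset, mem_roots_critTrinomial_sub_C hd]
        rcases Finset.mem_insert.1 hx with rfl | hx
        · exact hy
        · exact (Finset.mem_filter.1 hx).2
      have h2 := (Finset.card_le_card hsub).trans
        ((Multiset.toFinset_card_le _).trans (card_roots' _))
      rw [(critTrinomial_sub_C_monic hd β).2, Finset.card_insert_of_notMem fun h ↦ by
        have := (hfin (n + 1)).mem_toFinset.1 (Finset.mem_filter.1 h).1
        exact hy1.not_gt this.2] at h2
      omega
    · intro β hβ
      obtain ⟨x, hx, rfl⟩ := Finset.mem_image.1 hβ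
      obtain ⟨hx0, hx1⟩ := (hfin _).mem_toFinset.1 hx
      exact (hfin _).mem_toFinset.2 ⟨by rw [← aeval_polyIter_succ', hx0],
        norm_aeval_critTrinomial_lt_one hd hcL hdL hdL' hx1⟩

omit [IsAlgClosed L]

theorem norm_small_root_pow (hd0 : ((d - 1 : ℕ) : L) ≠ 0) {x : L}
    (hx : aeval x (polyIter (critTrinomial c d) (n + 1)) = 0) (hx1 : ‖x‖ < 1) :
    ‖x‖ ^ (d - 1) ^ (n + 1) = ‖((d - 1 : ℕ) : L)‖ := by
  have hpos : 0 < ‖((d - 1 : ℕ) : L)‖ := norm_pos_iff.2 hd0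
  have hpow := norm_pow_eq_norm_aeval_critTrinomial_sub (c := c) hd hcL hdL hx1
  induction n generalizing x with
  | zero =>
    rw [zero_add, polyIter_one] at hx
    rw [hx, zero_sub, norm_neg, norm_mul, hcL, one_mul] at hpow
    simpa using hpow
  | succ n ih =>
    have hβ1 := norm_aeval_critTrinomial_lt_one hd hcL hdL hdL' hx1
    rw [aeval_polyIter_succ'] at hx
    have h := ih hx hβ1 (norm_pow_eq_norm_aeval_critTrinomial_sub (c := c) hd hcL hdL hβ1)
    set β := aeval x (critTrinomial c d)
    have hlt : ‖((d - 1 : ℕ) : L)‖ < ‖β‖ := by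
      by_contra! hle
      have h2 : ‖((d - 1 : ℕ) : L)‖ ^ (d - 1) ^ (n + 1) < ‖((d - 1 : ℕ) : L)‖ :=
        pow_lt_self_of_lt_one₀ hpos hdL' (Nat.one_lt_pow (by omega) (by omega))
      exact (h.symm.trans_le (pow_le_pow_left₀ (norm_nonneg _) hle _)).not_gt h2
    rw [norm_sub_rev, norm_sub_eq_of_lt (by rwa [norm_mul, hcL, one_mul])] at hpow
    rw [pow_succ', pow_mul, hpow, h]

end SmallRoots

section Padic

theorem exists_algEquiv_of_ncard_le_natDegree_minpoly {k E : Type*} [Field k] [Field E]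
    [Algebra k E] [Normal k E] [CharZero k] {S : Set E} (hS : S.Finite) {x : E}
    (hinv : ∀ (σ : E ≃ₐ[k] E), σ x ∈ S)
    (hcard : S.ncard ≤ (minpoly k x).natDegree) {y : E} (hy : y ∈ S) :
    ∃ σ : E ≃ₐ[k] E, σ x = y := by
  classical
  have hint : IsIntegral k x := Algebra.IsIntegral.isIntegral x
  have hsub : (minpoly k x).rootSet E ⊆ S := by
    intro z hz
    obtain ⟨σ, rfl⟩ := isConjRoot_iff_exists_algEquiv.1
      ((isConjRoot_iff_mem_minpoly_rootSet hint).2 hz).symm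
    exact hinv σ
  have hc := card_rootSet_eq_natDegree (minpoly.irreducible hint).separable
    (Normal.splits inferInstance x)
  rw [← Nat.card_eq_fintype_card, Nat.card_coe_set_eq] at hc
  have heq := Set.eq_of_subset_of_ncard_le hsub (hcard.trans hc.ge) hS
  rw [← heq] at hy
  exact isConjRoot_iff_exists_algEquiv.1 ((isConjRoot_iff_mem_minpoly_rootSet hint).2 hy).symm

variable {q : ℕ} [Fact q.Prime] {L : Type*} [NormedField L] [Algebra ℚ_[q] L]

theorem dvd_natDegree_minpoly_of_norm_pow_eq {x : L} (hint : IsIntegral ℚ_[q] x)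
    (hnat : ∀ m : ℕ, ‖(m : L)‖ = ‖(m : ℚ_[q])‖)
    (hnorm : ‖x‖ ^ (minpoly ℚ_[q] x).natDegree = ‖(minpoly ℚ_[q] x).coeff 0‖)
    {M m : ℕ} (hM : M ≠ 0) (hm : m ≠ 0)
    (hx : ‖x‖ ^ M = ‖(m : L)‖) (hcop : M.Coprime (m.factorization q)) :
    M ∣ (minpoly ℚ_[q] x).natDegree := by
  have hq : 1 < (q : ℝ) := by exact_mod_cast (Fact.out : q.Prime).one_lt
  have hm' : (m : ℚ_[q]) ≠ 0 := by exact_mod_cast hm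
  have hx0 : x ≠ 0 := by
    rintro rfl
    rw [norm_zero, zero_pow hM, hnat] at hx
    exact hm' (norm_eq_zero.1 hx.symm)
  have ha := minpoly.coeff_zero_ne_zero hint hx0
  set D := (minpoly ℚ_[q] x).natDegree
  have h : ‖(minpoly ℚ_[q] x).coeff 0‖ ^ M = ‖(m : ℚ_[q])‖ ^ D := by
    rw [← hnorm, ← hnat, ← hx, pow_right_comm]
  rw [Padic.norm_eq_zpow_neg_valuation ha, Padic.norm_eq_zpow_neg_valuation hm',
    ← zpow_natCast, ← zpow_natCast, ← zpow_mul, ← zpow_mul,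
    zpow_right_inj₀ (by positivity) hq.ne', Padic.valuation_natCast,
    ← Nat.factorization_def _ Fact.out] at h
  have h2 : (M : ℤ) ∣ m.factorization q * D :=
    ⟨((minpoly ℚ_[q] x).coeff 0).valuation, by linear_combination h⟩
  exact hcop.dvd_of_dvd_mul_left (by exact_mod_cast h2)

theorem exists_root_with_transitive_stabilizer_padic [IsUltrametricDist L] [IsAlgClosed L]
    [CharZero L] [Normal ℚ_[q] L] (hnat : ∀ m : ℕ, ‖(m : L)‖ = ‖(m : ℚ_[q])‖)
    (hinv : ∀ (σ : L ≃ₐ[ℚ_[q]] L) (x : L), ‖σ x‖ = ‖x‖)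
    (hnorm : ∀ x : L, ‖x‖ ^ (minpoly ℚ_[q] x).natDegree = ‖(minpoly ℚ_[q] x).coeff 0‖)
    {c d : ℕ} (hd : 3 ≤ d) (hqd : q ∣ d - 1)
    (hcop : (d - 1).Coprime ((d - 1).factorization q)) (hcd : c.Coprime (d - 1)) (n : ℕ) :
    ∃ α : L, aeval α (polyIter (critTrinomial c d) (n + 1)) = 0 ∧
      ∀ x y, aeval x (critTrinomial c d) = aeval α (critTrinomial c d) →
        aeval y (critTrinomial c d) = aeval α (critTrinomial c d) → x ≠ α → y ≠ α →
        ∃ σ : L ≃ₐ[ℚ_[q]] L, σ α = α ∧ σ x = y := by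
  have hq : q.Prime := Fact.out
  have hcL : ‖(c : L)‖ = 1 := by
    rw [hnat, Padic.norm_natCast_eq_one_iff]
    exact (hcd.coprime_dvd_right hqd).symm
  have hdL : ‖(d : L)‖ = 1 := by
    rw [hnat, Padic.norm_natCast_eq_one_iff, hq.coprime_iff_not_dvd]
    intro h
    have := (Nat.dvd_sub h hqd)
    rw [Nat.sub_sub_self (by omega)] at this
    exact hq.one_lt.ne' (Nat.dvd_one.1 this)
  have hdL' : ‖((d - 1 : ℕ) : L)‖ < 1 := by
    rw [hnat, Padic.norm_natCast_lt_one_iff]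
    exact hqd
  have hd0 : ((d - 1 : ℕ) : L) ≠ 0 := by
    exact_mod_cast (by omega : d - 1 ≠ 0)
  have hcomm : ∀ (σ : L ≃ₐ[ℚ_[q]] L) x (g : ℤ[X]),
      aeval (σ x) g = σ (aeval x g) :=
    fun σ x g ↦ aeval_algHom_apply (σ.toAlgHom.restrictScalars ℤ) x g
  obtain ⟨β, hβ, hβ1⟩ := exists_small_root_polyIter (c := c) hd hcL hdL hdL' n
  obtain ⟨α, hα, hα1⟩ := exists_aeval_critTrinomial_eq_one_le_norm (c := c) hd hcL hdL β
  refine ⟨α, by rw [aeval_polyIter_succ', hα, hβ], fun x y hx hy hxα hyα ↦ ?_⟩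
  rw [hα] at hx hy
  have hsmall : ∀ z, aeval z (critTrinomial c d) = β → z ≠ α →
      z ∈ {z : L | aeval z (polyIter (critTrinomial c d) (n + 1)) = 0 ∧ ‖z‖ < 1} := by
    refine fun z hz hne ↦ ⟨by rw [aeval_polyIter_succ', hz, hβ], ?_⟩
    by_contra! h
    exact hne (eq_of_aeval_critTrinomial_eq_of_one_le_norm hd hcL hdL hdL' h hα1
      (by rw [hz, hα]) (by rwa [hz]))
  have hxS := hsmall x hx hxα
  have hdvd := dvd_natDegree_minpoly_of_norm_pow_eq (q := q)
    (Algebra.IsIntegral.isIntegral x) hnat (hnorm x) (pow_ne_zero _ (by omega)) (by omega)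
    (norm_small_root_pow (c := c) hd hcL hdL hdL' hd0 hxS.1 hxS.2) (hcop.pow_left _)
  have hconj : ∀ σ : L ≃ₐ[ℚ_[q]] L,
      σ x ∈ {z : L | aeval z (polyIter (critTrinomial c d) (n + 1)) = 0 ∧ ‖z‖ < 1} :=
    fun σ ↦ ⟨by rw [hcomm, hxS.1, map_zero], (hinv σ x).trans_lt hxS.2⟩
  obtain ⟨σ, hσ⟩ := exists_algEquiv_of_ncard_le_natDegree_minpoly (k := ℚ_[q])
    ((finite_aeval_polyIter_critTrinomial_eq_zero (c := c) hd (n + 1)).subset fun z hz ↦ hz.1)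
    hconj
    ((ncard_small_roots_polyIter_le hd hcL hdL hdL' _).trans (Nat.le_of_dvd
      (minpoly.natDegree_pos (Algebra.IsIntegral.isIntegral x)) hdvd)) (hsmall y hy hyα)
  have hσβ : σ β = β := by rw [← hx, ← hcomm, hσ, hx, hy]
  have hσα : aeval (σ α) (critTrinomial c d) = β := by rw [hcomm, hα, hσβ]
  refine ⟨σ, ?_, hσ⟩
  exact eq_of_aeval_critTrinomial_eq_of_one_le_norm hd hcL hdL hdL'
    (hα1.trans_eq (hinv σ α).symm) hα1 (by rw [hσα, hα]) (by rwa [hσα])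

end Padic

section Transfer

theorem PadicAlgCl.norm_pow_natDegree_minpoly {q : ℕ} [Fact q.Prime] (x : PadicAlgCl q) :
    ‖x‖ ^ (minpoly ℚ_[q] x).natDegree = ‖(minpoly ℚ_[q] x).coeff 0‖ := by
  have h := spectralNorm.spectralNorm_eq_norm_coeff_zero_rpow ℚ_[q] _ x
  rw [PadicAlgCl.spectralNorm_eq] at h
  rw [h, ← Real.rpow_natCast, ← Real.rpow_mul (norm_nonneg _), one_div_mul_cancel, Real.rpow_one]
  exact_mod_cast (minpoly.natDegree_pos (Algebra.IsIntegral.isIntegral x)).ne'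

/-- Automorphisms of an algebraically closed overfield restrict to a normal extension, so the
existence of a root with large orbits of its stabilizer descends. -/
theorem exists_root_with_transitive_stabilizer_of_algClosed {K L : Type*} [Field K] [Algebra ℚ K]
    [Normal ℚ K] [Field L] [Algebra ℚ L] [IsAlgClosed L] {φ f : ℤ[X]} (hf : f.Monic)
    (hsplit : (f.map (algebraMap ℤ K)).Splits)
    (h : ∃ α : L, aeval α f = 0 ∧ ∀ x y, aeval x φ = aeval α φ → aeval y φ = aeval α φ →
      x ≠ α → y ≠ α → ∃ σ : L ≃ₐ[ℚ] L, σ α = α ∧ σ x = y) :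
    ∃ α : K, aeval α f = 0 ∧ ∀ x y, aeval x φ = aeval α φ → aeval y φ = aeval α φ →
      x ≠ α → y ≠ α → ∃ σ : K ≃ₐ[ℚ] K, σ α = α ∧ σ x = y := by
  let ι : K →ₐ[ℚ] L := IsAlgClosed.lift
  algebraize [ι.toRingHom]
  have : IsScalarTower ℚ K L := IsScalarTower.of_algebraMap_eq' ι.comp_algebraMap.symm
  have hcoe : ∀ (x : K) (g : ℤ[X]), aeval (algebraMap K L x) g = algebraMap K L (aeval x g) :=
    fun x g ↦ aeval_algebraMap_apply _ _ _
  obtain ⟨α', hα', h⟩ := h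
  obtain ⟨α, rfl⟩ : ∃ α : K, algebraMap K L α = α' := by
    refine hsplit.mem_range_of_isRoot (hf.map _).ne_zero ?_
    rwa [IsRoot, eval_map_algebraMap, aeval_map_algebraMap]
  have hinj := (algebraMap K L).injective
  rw [hcoe, map_eq_zero] at hα'
  refine ⟨α, hα', fun x y hx hy hxα hyα ↦ ?_⟩
  obtain ⟨σ, hσ, hσ'⟩ := h (algebraMap K L x) (algebraMap K L y) (by rw [hcoe, hcoe, hx])
    (by rw [hcoe, hcoe, hy]) (hinj.ne hxα) (hinj.ne hyα)
  refine ⟨σ.restrictNormal K, hinj ?_, hinj ?_⟩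
  · rw [AlgEquiv.restrictNormal_commutes, hσ]
  · rw [AlgEquiv.restrictNormal_commutes, hσ']

theorem exists_root_with_transitive_stabilizer {K : Type*} [Field K] [Algebra ℚ K] [Normal ℚ K]
    {q c d n : ℕ} (hq : q.Prime) (hd : 3 ≤ d) (hqd : q ∣ d - 1)
    (hcop : (d - 1).Coprime ((d - 1).factorization q)) (hcd : c.Coprime (d - 1))
    (hsplit : ((polyIter (critTrinomial c d) (n + 1)).map (algebraMap ℤ K)).Splits) :
    ∃ α : K, aeval α (polyIter (critTrinomial c d) (n + 1)) = 0 ∧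
      ∀ x y, aeval x (critTrinomial c d) = aeval α (critTrinomial c d) →
        aeval y (critTrinomial c d) = aeval α (critTrinomial c d) → x ≠ α → y ≠ α →
        ∃ σ : K ≃ₐ[ℚ] K, σ α = α ∧ σ x = y := by
  have := Fact.mk hq
  have hm := critTrinomial_monic (c := c) (d := d) (by omega)
  have hdeg := critTrinomial_natDegree (c := c) (d := d) (by omega)
  refine exists_root_with_transitive_stabilizer_of_algClosed (L := PadicAlgCl q)
    (hm.polyIter (by omega) _) hsplit ?_
  have key := exists_root_with_transitive_stabilizer_padic (q := q) (L := PadicAlgCl q)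
    (fun m ↦ by rw [← PadicAlgCl.norm_extends, map_natCast])
    (fun σ x ↦ (spectralNorm_eq_of_equiv σ x).symm)
    PadicAlgCl.norm_pow_natDegree_minpoly hd hqd hcop hcd n
  obtain ⟨α, hα, h⟩ := key
  refine ⟨α, hα, fun x y hx hy hxα hyα ↦ ?_⟩
  obtain ⟨σ, hσ, hσ'⟩ := h x y hx hy hxα hyα
  exact ⟨σ.restrictScalars ℚ, hσ, hσ'⟩

end Transfer

theorem card_fixing_Kfield_critTrinomial {K : Type} [Field K] [inst : Algebra ℚ K]
    {c d m p : ℕ}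
    [IsSplittingField ℚ K ((polyIter (critTrinomial c d) (m + 1)).map (algebraMap ℤ ℚ))]
    (hd : 3 ≤ d) (ι : K →ₐ[ℚ] AlgebraicClosure ℚ)
    (hι : ι.fieldRange = Kfield (critTrinomial c d) (m + 1))
    (hcase : d.Prime ∨ ∃ q : ℕ, q.Prime ∧ q ∣ (d - 1) ∧
      Nat.gcd (d - 1) ((d - 1).factorization q) = 1)
    (hgcd : Nat.gcd c (d - 1) = 1)
    (hirr : Irreducible ((polyIter (critTrinomial c d) (m + 1)).map (algebraMap ℤ ℚ)))
    (hp : p.Prime) (hpd : ¬ p ∣ d)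
    (hprim : ∀ k, 1 ≤ k → k ≤ m + 1 → ¬ (p : ℤ) ∣ critOrbit c d k)
    (hodd : Odd ((critOrbit c d (m + 1 + 1)).natAbs.factorization p)) :
    Nat.card {σ : K ≃ₐ[ℚ] K // ∀ y, ι y ∈ Kfield (critTrinomial c d) m → σ y = y} =
      d.factorial ^ d ^ m := by
  have hdeg := critTrinomial_natDegree (c := c) (d := d) (by omega)
  set f := (polyIter (critTrinomial c d) (m + 1)).map (algebraMap ℤ ℚ) with hf
  have hfin := IsSplittingField.finiteDimensional K f
  have hnorm := Normal.of_isSplittingField (F := ℚ) (E := K) f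
  have hchar : CharZero K := algebraRat.charZero K
  obtain rfl : inst = DivisionRing.toRatAlgebra := Subsingleton.elim _ _
  have hnf : NumberField K := ⟨⟩
  have hgal : IsGalois ℚ K := ⟨⟩
  have hsplit : ((polyIter (critTrinomial c d) (m + 1)).map (algebraMap ℤ K)).Splits :=
    splits_map_of_isSplittingField
  have := card_fixing_Kfield_eq (critTrinomial_monic (by omega)) (by rwa [hdeg]) ι hι hirr
    (exists_galois_swap_critTrinomial hd (by omega) hsplit eq_one_of_forall_root hp hpd hprim hodd)
    (by
      rw [hdeg]
      exact hcase.imp_right fun ⟨q, hq, hqd, hcop⟩ ↦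
        exists_root_with_transitive_stabilizer hq hd hqd hcop hgcd hsplit)
  rwa [hdeg] at this

/-- Fix `d ≥ 3` which is prime or such that some prime `q ∣ d-1` satisfies
`gcd(d-1, v_q(d-1)) = 1`. Assume the Vojta-type hypothesis: there are constants `C₁, C₂`
such that for every degree-`d` polynomial `f ∈ ℤ[x]` with nonzero discriminant (i.e. squarefree
over `ℚ`) and all integers `x, y` with `y² = f(x)` one has `log max(1,|x|) ≤ C₁·h(f) + C₂`.
Let `φ_c(x) = x^d - cd·x^{d-1} + c(d-1)`. Then for every positive integer `c` with all
iterates `φ_c^n` irreducible over `ℚ` and `gcd(c, d-1) = 1`, there exists `N` such that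
for all `n > N` the extension `K_n/K_{n-1}` is maximal, i.e. `Gal(K_n/K_{n-1})` has order
`(d!)^(d^(n-1))`. -/
theorem stmt_2 (d : ℕ) (hd : 3 ≤ d)
    (hcase : d.Prime ∨ ∃ q : ℕ, q.Prime ∧ q ∣ (d - 1) ∧
      Nat.gcd (d - 1) ((d - 1).factorization q) = 1)
    (hVojta : ∃ C₁ C₂ : ℝ, ∀ f : Polynomial ℤ, f.natDegree = d →
      Squarefree (f.map (algebraMap ℤ ℚ)) →
      ∀ x y : ℤ, y ^ 2 = f.eval x →
        Real.log (max 1 |(x : ℝ)|) ≤ C₁ * intPolyHeight f + C₂)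
    (c : ℕ) (hc : 0 < c)
    (φ : Polynomial ℤ)
    (hφ : φ = X ^ d - C ((c : ℤ) * d) * X ^ (d - 1) + C ((c : ℤ) * ((d : ℤ) - 1)))
    (hirr : ∀ n : ℕ, 1 ≤ n → Irreducible ((polyIter φ n).map (algebraMap ℤ ℚ)))
    (hgcd : Nat.gcd c (d - 1) = 1) :
    ∃ N : ℕ, ∀ n : ℕ, N < n → relGalCard φ n = (Nat.factorial d) ^ (d ^ (n - 1)) := by
  obtain rfl : φ = critTrinomial c d := hφ
  have hirr1 := hirr 1 le_rfl
  rw [polyIter_one] at hirr1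
  have hc2 := two_le_of_irreducible_critTrinomial hd hc hirr1
  obtain ⟨N, hN⟩ := exists_primitive_prime_odd_factorization (a := critOrbit c d) hVojta
    (critTrinomial_natDegree (by omega)) hirr1.squarefree critOrbit_zero critOrbit_succ
    (four_le_abs_critOrbit_one hd hc2) (fun n hn ↦ (critOrbit_growth hd hc2 n hn).1)
    (E := d) (by omega)
  refine ⟨N, fun n hn ↦ ?_⟩
  obtain ⟨p, hp, hpd, hprim, hodd⟩ := hN n hn
  obtain ⟨m, rfl⟩ := Nat.exists_eq_add_of_le' (Nat.one_le_of_lt hn)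
  have := isSplittingField_Kfield (φ := critTrinomial c d) (n := m + 1)
  rw [relGalCard_succ, Nat.add_sub_cancel]
  exact card_fixing_Kfield_critTrinomial hd _ (IntermediateField.fieldRange_val _) hcase hgcd
    (hirr _ (by omega)) hp hpd hprim hodd
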